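/- arXiv:1004.4677 — 2 statements merged into one kernel-verified Lean document; each statement's English description precedes it below -/
import Mathlib

section
/- Let G be a group and {H_α}_{α∈Λ} a family of subgroups, and let Δ = ker(⊕_{α∈Λ} ℤ[G/H_α] → ℤ) be the kernel of the augmentation sending each coset gH_α to 1. Suppose: (1) Λ is finite; (2) each H_α is finitely generated; (3) G is finitely presented; and (4) Tor_i^{ℤ[G]}(Δ, ∏ ℤ[G]) = 0 for all 1 ≤ i ≤ n−1 and all direct products of copies of ℤ[G]. Then Δ is of type FP^n over ℤ[G]. -/
open scoped BigOperators

/-- `G` is finitely presented. -/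
def IsFinitelyPresented (G : Type) [Group G] : Prop :=
  ∃ (n : ℕ) (rels : Set (FreeGroup (Fin n))),
    rels.Finite ∧ Nonempty (G ≃* PresentedGroup rels)

variable (G : Type) [Group G]

/-- The `G`-set `⊔_α G/H_α` underlying `⊕_α ℤ[G/H_α]`. -/
abbrev cosetUnion {Λ : Type} (H : Λ → Subgroup G) : Type := Σ α : Λ, G ⧸ H α

/-- The augmentation kernel `Δ = ker (⊕_α ℤ[G/H_α] → ℤ)` (as a set of chains;
it is a `G`-invariant subgroup, i.e. a `ℤ[G]`-submodule). -/
def deltaSet {Λ : Type} (H : Λ → Subgroup G) : Set ((cosetUnion G H) →₀ ℤ) :=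
  {v | (v.sum fun _ m => m) = 0}

/-- The left `G`-translation on a free `ℤ[G]`-module `(G × B) →₀ ℤ` with
`ℤ[G]`-basis `B`. -/
noncomputable def freeShift {B : Type} (g : G) (x : (G × B) →₀ ℤ) : (G × B) →₀ ℤ :=
  Finsupp.mapDomain (fun p => (g * p.1, p.2)) x

/-- The `G`-translation on `⊕_α ℤ[G/H_α]`. -/
noncomputable def cosetShift {Λ : Type} (H : Λ → Subgroup G) (g : G)
    (x : (cosetUnion G H) →₀ ℤ) : (cosetUnion G H) →₀ ℤ :=
  Finsupp.mapDomain (fun q : cosetUnion G H => (⟨q.1, g • q.2⟩ : cosetUnion G H)) x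

/-- Tensoring a map of free `ℤ[G]`-modules (given by `d` on the chosen bases) with a
direct product `∏_ι ℤ[G]` of copies of `ℤ[G]` over `ℤ[G]`:  the result is the induced
map `B' →₀ ∏_ι ℤ[G] → B →₀ ∏_ι ℤ[G]`, using the identifications
`(∏_ι ℤ[G]) ⊗_{ℤ[G]} ((G × B) →₀ ℤ) ≅ B →₀ ∏_ι ℤ[G]`. -/
noncomputable def tensorProd {ι B B' : Type}
    (d : ((G × B') →₀ ℤ) →ₗ[ℤ] ((G × B) →₀ ℤ))
    (v : B' →₀ (ι → MonoidAlgebra ℤ G)) : B →₀ (ι → MonoidAlgebra ℤ G) :=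
  v.sum fun b x =>
    (d (Finsupp.single ((1 : G), b) 1)).sum fun p c =>
      Finsupp.single p.2 (c • fun j => x j * MonoidAlgebra.of ℤ G p.1)


/-! ### Conversion between `(G × B) →₀ ℤ` and `B →₀ ℤ[G]` -/

/-- The identification of the free module `(G × B) →₀ ℤ` with `B →₀ ℤ[G]`. -/
noncomputable def eqv (B : Type) : ((G × B) →₀ ℤ) ≃+ (B →₀ MonoidAlgebra ℤ G) :=
  ((Finsupp.domLCongr (R := ℤ) (M := ℤ) (Equiv.prodComm G B)).toAddEquiv.trans
    (Finsupp.curryLinearEquiv ℤ).toAddEquiv).trans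
    (Finsupp.mapRange.addEquiv MonoidAlgebra.coeffAddEquiv.symm)

theorem eqv_single {B : Type} (g : G) (b : B) (c : ℤ) :
    eqv G B (Finsupp.single (g, b) c) = Finsupp.single b (MonoidAlgebra.single g c) := by
  simp [eqv, Finsupp.curryLinearEquiv]

theorem eqv_shift {B : Type} (g : G) (x : (G × B) →₀ ℤ) :
    eqv G B (freeShift G g x) = MonoidAlgebra.of ℤ G g • eqv G B x := by
  induction x using Finsupp.induction_linear with
  | zero => simp [freeShift]
  | add f h hf hh =>
    have : freeShift G g (f + h) = freeShift G g f + freeShift G g h := Finsupp.mapDomain_add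
    rw [this, map_add, map_add, hf, hh, smul_add]
  | single p c =>
    obtain ⟨a, b⟩ := p
    simp [freeShift, Finsupp.mapDomain_single, eqv_single, MonoidAlgebra.single_mul_single]

/-- The integral form of an `ℤ[G]`-linear map of free modules. -/
noncomputable def unconv {B B' : Type}
    (f : (B' →₀ MonoidAlgebra ℤ G) →ₗ[MonoidAlgebra ℤ G] (B →₀ MonoidAlgebra ℤ G)) :
    ((G × B') →₀ ℤ) →ₗ[ℤ] ((G × B) →₀ ℤ) :=
  ((eqv G B).symm.toAddMonoidHom.comp
    (f.toAddMonoidHom.comp (eqv G B').toAddMonoidHom)).toIntLinearMap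

theorem eqv_unconv {B B' : Type}
    (f : (B' →₀ MonoidAlgebra ℤ G) →ₗ[MonoidAlgebra ℤ G] (B →₀ MonoidAlgebra ℤ G))
    (x : (G × B') →₀ ℤ) : eqv G B (unconv G f x) = f (eqv G B' x) := by
  simp [unconv]

theorem unconv_shift {B B' : Type}
    (f : (B' →₀ MonoidAlgebra ℤ G) →ₗ[MonoidAlgebra ℤ G] (B →₀ MonoidAlgebra ℤ G))
    (g : G) (x : (G × B') →₀ ℤ) :
    unconv G f (freeShift G g x) = freeShift G g (unconv G f x) := by
  apply (eqv G B).injective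
  rw [eqv_unconv, eqv_shift, eqv_shift, eqv_unconv, map_smul]

theorem unconv_exact {B B' B'' : Type}
    (f : (B' →₀ MonoidAlgebra ℤ G) →ₗ[MonoidAlgebra ℤ G] (B →₀ MonoidAlgebra ℤ G))
    (f' : (B'' →₀ MonoidAlgebra ℤ G) →ₗ[MonoidAlgebra ℤ G] (B' →₀ MonoidAlgebra ℤ G))
    (h : LinearMap.range f' = LinearMap.ker f) (x : (G × B') →₀ ℤ) :
    unconv G f x = 0 ↔ ∃ y, unconv G f' y = x := by
  rw [← (eqv G B).map_eq_zero_iff, eqv_unconv, ← LinearMap.mem_ker, ← h, LinearMap.mem_range]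
  constructor
  · rintro ⟨y, hy⟩
    refine ⟨(eqv G B'').symm y, (eqv G B').injective ?_⟩
    rw [eqv_unconv, AddEquiv.apply_symm_apply, hy]
  · rintro ⟨y, rfl⟩
    exact ⟨eqv G B'' y, (eqv_unconv G f' y).symm⟩

/-- Evaluation at a coordinate of the product. -/
noncomputable def evC {ι B : Type} (k : ι) :
    (B →₀ (ι → MonoidAlgebra ℤ G)) →+ (B →₀ MonoidAlgebra ℤ G) :=
  Finsupp.mapRange.addMonoidHom (Pi.evalAddMonoidHom _ k)

theorem evC_apply {ι B : Type} (k : ι) (y : B →₀ (ι → MonoidAlgebra ℤ G)) (b : B) :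
    evC G k y b = y b k := by
  simp [evC]

theorem evC_single {ι B : Type} (k : ι) (b : B) (x : ι → MonoidAlgebra ℤ G) :
    evC G k (Finsupp.single b x) = Finsupp.single b (x k) := by
  simp [evC]

theorem evC_inner {ι B : Type} (k : ι) (x : ι → MonoidAlgebra ℤ G) (w : (G × B) →₀ ℤ) :
    evC G k (w.sum fun p c =>
      Finsupp.single p.2 (c • fun j => x j * MonoidAlgebra.of ℤ G p.1)) = x k • eqv G B w := by
  induction w using Finsupp.induction_linear with
  | zero => simp
  | add f h hf hh =>
    rw [Finsupp.sum_add_index', map_add, hf, hh, map_add, smul_add]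
    · intro p; simp
    · intro p c c'; rw [add_smul, Finsupp.single_add]
  | single p c =>
    obtain ⟨a, b⟩ := p
    rw [Finsupp.sum_single_index (by simp), evC_single, eqv_single, Finsupp.smul_single]
    congr 1
    have : (MonoidAlgebra.single a c : MonoidAlgebra ℤ G) = c • MonoidAlgebra.of ℤ G a := by
      simp
    rw [this, smul_eq_mul, mul_smul_comm]
    rfl

theorem evC_tensor {ι B B' : Type}
    (f : (B' →₀ MonoidAlgebra ℤ G) →ₗ[MonoidAlgebra ℤ G] (B →₀ MonoidAlgebra ℤ G))
    (k : ι) (y : B' →₀ (ι → MonoidAlgebra ℤ G)) :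
    evC G k (tensorProd G (unconv G f) y) = f (evC G k y) := by
  have key : ∀ (b : B') (x : ι → MonoidAlgebra ℤ G),
      evC G k ((unconv G f (Finsupp.single ((1 : G), b) 1)).sum fun p c =>
        Finsupp.single p.2 (c • fun j => x j * MonoidAlgebra.of ℤ G p.1))
      = f (evC G k (Finsupp.single b x)) := by
    intro b x
    rw [evC_inner, eqv_unconv, eqv_single, evC_single, ← map_smul, Finsupp.smul_single,
      smul_eq_mul]
    congr 2
    exact mul_one _
  conv_rhs => rw [← Finsupp.sum_single y]
  unfold tensorProd
  rw [map_finsuppSum, map_finsuppSum, map_finsuppSum]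
  exact Finset.sum_congr rfl fun b _ => key b (y b)

/-- The key finiteness step. -/
theorem ker_fg_of_tensor {B0 B1 B2 : Type} [Finite B1]
    (f : (B1 →₀ MonoidAlgebra ℤ G) →ₗ[MonoidAlgebra ℤ G] (B0 →₀ MonoidAlgebra ℤ G))
    (f' : (B2 →₀ MonoidAlgebra ℤ G) →ₗ[MonoidAlgebra ℤ G] (B1 →₀ MonoidAlgebra ℤ G))
    (hr : LinearMap.range f' = LinearMap.ker f)
    (h : ∀ (ι : Type) (y : B1 →₀ (ι → MonoidAlgebra ℤ G)),
      tensorProd G (unconv G f) y = 0 → ∃ z, tensorProd G (unconv G f') z = y) :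
    (LinearMap.ker f).FG := by
  classical
  let y : B1 →₀ (LinearMap.ker f → MonoidAlgebra ℤ G) :=
    Finsupp.equivFunOnFinite.symm fun b k => k.1 b
  have hy : ∀ k : LinearMap.ker f, evC G k y = k.1 := by
    intro k; ext1 b; rw [evC_apply]; rfl
  obtain ⟨z, hz⟩ := h (LinearMap.ker f) y (by
    ext1 b; funext k
    rw [← evC_apply, evC_tensor, hy, LinearMap.mem_ker.1 k.2]; rfl)
  refine ⟨z.support.image fun s => f' (Finsupp.single s 1), le_antisymm ?_ ?_⟩
  · rw [Submodule.span_le]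
    intro v hv
    simp only [Finset.coe_image, Set.mem_image] at hv
    obtain ⟨s, -, rfl⟩ := hv
    rw [← hr]
    exact LinearMap.mem_range_self _ _
  · intro v hv
    have h1 : f' (evC G ⟨v, hv⟩ z) = v := by
      rw [← evC_tensor, hz, hy]
    have h2 : f' (evC G ⟨v, hv⟩ z)
        = z.sum fun s x => f' (evC G ⟨v, hv⟩ (Finsupp.single s x)) := by
      conv_lhs => rw [← Finsupp.sum_single z]
      rw [map_finsuppSum, map_finsuppSum]
    rw [← h1, h2]
    refine Submodule.sum_mem _ fun s hs => ?_
    have : f' (evC G ⟨v, hv⟩ (Finsupp.single s (z s)))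
        = (z s ⟨v, hv⟩) • f' (Finsupp.single s 1) := by
      rw [evC_single, ← map_smul, Finsupp.smul_single, smul_eq_mul, mul_one]
    change f' (evC G ⟨v, hv⟩ (Finsupp.single s (z s))) ∈ _
    rw [this]
    exact Submodule.smul_mem _ _ (Submodule.subset_span (by
      simp only [Finset.coe_image]; exact Set.mem_image_of_mem _ hs))

/-! ### Building resolutions -/

theorem exists_cover {R : Type} [Ring R] (S : Σ B : Type, Submodule R (B →₀ R)) :
    ∃ (C : Type) (g : (C →₀ R) →ₗ[R] (S.1 →₀ R)),
      LinearMap.range g = S.2 ∧ (S.2.FG → Finite C) := by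
  obtain ⟨B, K⟩ := S
  by_cases h : K.FG
  · obtain ⟨s, hs⟩ := h
    refine ⟨s, Finsupp.linearCombination R (fun x : s => (x : B →₀ R)), ?_, fun _ => inferInstance⟩
    rw [Finsupp.range_linearCombination]
    simpa using hs
  · refine ⟨K, Finsupp.linearCombination R (fun x : K => (x : B →₀ R)), ?_, fun h' => (h h').elim⟩
    rw [Finsupp.range_linearCombination]
    simp

theorem exists_resolution {R : Type} [Ring R] {M : Type} [AddCommGroup M] [Module R M]
    {B0 : Type} [hB0 : Finite B0] (p : (B0 →₀ R) →ₗ[R] M) (hk : (LinearMap.ker p).FG) :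
    ∃ (Bs : ℕ → Type) (d : ∀ i, (Bs (i + 1) →₀ R) →ₗ[R] (Bs i →₀ R)) (π : (Bs 0 →₀ R) →ₗ[R] M),
      LinearMap.range π = LinearMap.range p ∧ LinearMap.range (d 0) = LinearMap.ker π ∧
      (∀ i, LinearMap.range (d (i + 1)) = LinearMap.ker (d i)) ∧
      Finite (Bs 0) ∧ Finite (Bs 1) ∧
      (∀ i, (LinearMap.ker (d i)).FG → Finite (Bs (i + 2))) := by
  choose C g hg hC using fun S : (Σ B : Type, Submodule R (B →₀ R)) => exists_cover S
  let σ : ℕ → (Σ B : Type, Submodule R (B →₀ R)) := fun i =>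
    Nat.rec ⟨B0, LinearMap.ker p⟩ (fun _ S => ⟨C S, LinearMap.ker (g S)⟩) i
  exact ⟨fun i => (σ i).1, fun i => g (σ i), p, rfl, hg (σ 0), fun i => hg (σ (i + 1)), hB0,
    hC (σ 0) hk, fun i h => hC (σ (i + 1)) h⟩

theorem exists_fin {R : Type} [Ring R] (B : Type) :
    ∃ (a : (Fin (Nat.card B) →₀ R) →ₗ[R] (B →₀ R)) (b : (B →₀ R) →ₗ[R] (Fin (Nat.card B) →₀ R)),
      Finite B → (∀ x, a (b x) = x) ∧ (∀ x, b (a x) = x) := by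
  by_cases h : Finite B
  · let e := Finsupp.domLCongr (R := R) (M := R) (Finite.equivFin B)
    exact ⟨e.symm.toLinearMap, e.toLinearMap, fun _ =>
      ⟨fun x => e.symm_apply_apply x, fun x => e.apply_symm_apply x⟩⟩
  · exact ⟨0, 0, fun h' => (h h').elim⟩

theorem FPn_of_presentation {Λ : Type} (H : Λ → Subgroup G) (n : ℕ)
    {M : Type} [AddCommGroup M] [Module (MonoidAlgebra ℤ G) M]
    (E : ((cosetUnion G H) →₀ ℤ) ≃+ M)
    (hE : ∀ g v, E (cosetShift G H g v) = MonoidAlgebra.of ℤ G g • E v)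
    {B0 : Type} [Finite B0] (p : (B0 →₀ MonoidAlgebra ℤ G) →ₗ[MonoidAlgebra ℤ G] M)
    (hk : (LinearMap.ker p).FG)
    (hp : ∀ v, E v ∈ LinearMap.range p ↔ v ∈ deltaSet G H)
    (hTor : ∀ (Bs : ℕ → Type)
      (d : ∀ i : ℕ, ((G × Bs (i + 1)) →₀ ℤ) →ₗ[ℤ] ((G × Bs i) →₀ ℤ))
      (π : ((G × Bs 0) →₀ ℤ) →ₗ[ℤ] ((cosetUnion G H) →₀ ℤ)),
      (∀ (i : ℕ) (g : G) (x : (G × Bs (i + 1)) →₀ ℤ),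
        d i (freeShift G g x) = freeShift G g (d i x)) →
      (∀ (g : G) (x : (G × Bs 0) →₀ ℤ), π (freeShift G g x) = cosetShift G H g (π x)) →
      Set.range π = deltaSet G H →
      (∀ x : (G × Bs 0) →₀ ℤ, π x = 0 ↔ ∃ y, d 0 y = x) →
      (∀ (i : ℕ) (x : (G × Bs (i + 1)) →₀ ℤ), d i x = 0 ↔ ∃ y, d (i + 1) y = x) →
      ∀ (ι : Type) (i : ℕ), i + 2 ≤ n →
        ∀ y : Bs (i + 1) →₀ (ι → MonoidAlgebra ℤ G),
          tensorProd G (d i) y = 0 → ∃ z, tensorProd G (d (i + 1)) z = y) :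
    ∃ (m : ℕ → ℕ)
      (d : ∀ i : ℕ, ((G × Fin (m (i + 1))) →₀ ℤ) →ₗ[ℤ] ((G × Fin (m i)) →₀ ℤ))
      (π : ((G × Fin (m 0)) →₀ ℤ) →ₗ[ℤ] ((cosetUnion G H) →₀ ℤ)),
      (∀ (i : ℕ) (g : G) (x : (G × Fin (m (i + 1))) →₀ ℤ),
        d i (freeShift G g x) = freeShift G g (d i x)) ∧
      (∀ (g : G) (x : (G × Fin (m 0)) →₀ ℤ), π (freeShift G g x) = cosetShift G H g (π x)) ∧
      Set.range π = deltaSet G H ∧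
      (1 ≤ n → ∀ x : (G × Fin (m 0)) →₀ ℤ, π x = 0 ↔ ∃ y, d 0 y = x) ∧
      (∀ i : ℕ, i + 2 ≤ n →
        ∀ x : (G × Fin (m (i + 1))) →₀ ℤ, d i x = 0 ↔ ∃ y, d (i + 1) y = x) := by
  -- transfer of augmentation maps
  let U : ∀ (B : Type), ((B →₀ MonoidAlgebra ℤ G) →ₗ[MonoidAlgebra ℤ G] M) →
      (((G × B) →₀ ℤ) →ₗ[ℤ] ((cosetUnion G H) →₀ ℤ)) := fun B f =>
    (E.symm.toAddMonoidHom.comp (f.toAddMonoidHom.comp (eqv G B).toAddMonoidHom)).toIntLinearMap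
  have hU : ∀ B f x, E (U B f x) = f (eqv G B x) := by
    intro B f x; simp [U]
  have hUs : ∀ B f (g : G) x, U B f (freeShift G g x) = cosetShift G H g (U B f x) := by
    intro B f g x
    apply E.injective
    rw [hU, eqv_shift, hE, hU, map_smul]
  have hUr : ∀ B f, LinearMap.range f = LinearMap.range p → Set.range (U B f) = deltaSet G H := by
    intro B f hf
    ext v
    rw [← hp, ← hf]
    constructor
    · rintro ⟨x, rfl⟩
      exact ⟨eqv G B x, (hU B f x).symm⟩
    · rintro ⟨x, hx⟩
      refine ⟨(eqv G B).symm x, E.injective ?_⟩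
      rw [hU, AddEquiv.apply_symm_apply, hx]
  have hUe : ∀ (B B' : Type) (f : (B →₀ MonoidAlgebra ℤ G) →ₗ[MonoidAlgebra ℤ G] M)
      (f' : (B' →₀ MonoidAlgebra ℤ G) →ₗ[MonoidAlgebra ℤ G] (B →₀ MonoidAlgebra ℤ G)),
      LinearMap.range f' = LinearMap.ker f →
      ∀ x, U B f x = 0 ↔ ∃ y, unconv G f' y = x := by
    intro B B' f f' h x
    rw [← E.map_eq_zero_iff, hU, ← LinearMap.mem_ker, ← h, LinearMap.mem_range]
    constructor
    · rintro ⟨y, hy⟩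
      refine ⟨(eqv G B').symm y, (eqv G B).injective ?_⟩
      rw [eqv_unconv, AddEquiv.apply_symm_apply, hy]
    · rintro ⟨y, rfl⟩
      exact ⟨eqv G B' y, (eqv_unconv G f' y).symm⟩
  obtain ⟨Bs, d, π, hπ, h0, hd, f0, f1, f2⟩ := exists_resolution p hk
  have T := hTor Bs (fun i => unconv G (d i)) (U _ π) (fun i => unconv_shift G (d i))
    (hUs _ π) (hUr _ π hπ) (hUe _ _ π (d 0) h0)
    (fun i => unconv_exact G (d i) (d (i + 1)) (hd i))
  have hfin : ∀ i, i + 1 ≤ n → Finite (Bs (i + 1)) := by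
    intro i
    induction i with
    | zero => intro _; exact f1
    | succ i ih =>
      intro hi
      have := ih (by omega)
      exact f2 i (ker_fg_of_tensor G (d i) (d (i + 1)) (hd i) (fun ι => T ι i hi))
  choose a b hab using fun B : Type => exists_fin (R := MonoidAlgebra ℤ G) B
  let d' : ∀ i, (Fin (Nat.card (Bs (i + 1))) →₀ MonoidAlgebra ℤ G) →ₗ[MonoidAlgebra ℤ G]
      (Fin (Nat.card (Bs i)) →₀ MonoidAlgebra ℤ G) := fun i => b (Bs i) ∘ₗ d i ∘ₗ a (Bs (i + 1))
  let π' := π ∘ₗ a (Bs 0)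
  refine ⟨fun i => Nat.card (Bs i), fun i => unconv G (d' i), U _ π',
    fun i => unconv_shift G (d' i), hUs _ π', hUr _ π' ?_, fun hn => hUe _ _ π' (d' 0) ?_,
    fun i hi => unconv_exact G (d' i) (d' (i + 1)) ?_⟩
  · rw [← hπ]
    ext v
    constructor
    · rintro ⟨x, rfl⟩
      exact ⟨_, rfl⟩
    · rintro ⟨x, rfl⟩
      exact ⟨b _ x, by simp [π', (hab _ f0).1]⟩
  · have := hfin 0 hn
    ext v
    rw [LinearMap.mem_ker]
    change _ ↔ π (a (Bs 0) v) = 0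
    rw [← LinearMap.mem_ker, ← h0]
    constructor
    · rintro ⟨x, rfl⟩
      exact ⟨a (Bs 1) x, by simp [d', (hab _ f0).1]⟩
    · rintro ⟨x, hx⟩
      exact ⟨b (Bs 1) x, by simp [d', (hab _ f1).1, hx, (hab _ f0).2]⟩
  · have g1 := hfin i (by omega)
    have g2 := hfin (i + 1) hi
    have g0 : Finite (Bs i) := by
      cases i with
      | zero => exact f0
      | succ i => exact hfin i (by omega)
    ext v
    have : d' i v = 0 ↔ d i (a (Bs (i + 1)) v) = 0 := by
      constructor
      · intro h
        have h' : b (Bs i) (d i (a (Bs (i + 1)) v)) = 0 := h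
        rw [← (hab _ g0).1 (d i (a (Bs (i + 1)) v)), h', map_zero]
      · intro h
        change b (Bs i) (d i (a (Bs (i + 1)) v)) = 0
        rw [h, map_zero]
    rw [LinearMap.mem_ker, this, ← LinearMap.mem_ker, ← hd i]
    constructor
    · rintro ⟨x, rfl⟩
      exact ⟨a (Bs (i + 2)) x, by simp [d', (hab _ g1).1]⟩
    · rintro ⟨x, hx⟩
      exact ⟨b (Bs (i + 2)) x, by simp [d', (hab _ g2).1, hx, (hab _ g1).2]⟩

/-! ### Finite presentation of the augmentation kernel (Fox calculus) -/

theorem exists_deriv {W : Type} [AddCommGroup W] [Module (MonoidAlgebra ℤ G) W] {k : ℕ}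
    (q : FreeGroup (Fin k) →* G) (a : Fin k → W) :
    ∃ D : FreeGroup (Fin k) → W, (∀ j, D (FreeGroup.of j) = a j) ∧
      ∀ u v, D (u * v) = D u + MonoidAlgebra.of ℤ G (q u) • D v := by
  let o := MonoidAlgebra.of ℤ G
  have ho1 : ∀ (g : G) (w : W), o g • o g⁻¹ • w = w := by
    intro g w; rw [← mul_smul, ← map_mul, mul_inv_cancel, map_one, one_smul]
  have ho2 : ∀ (g : G) (w : W), o g⁻¹ • o g • w = w := by
    intro g w; rw [← mul_smul, ← map_mul, inv_mul_cancel, map_one, one_smul]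
  let F : Fin k → Equiv.Perm W := fun j =>
    { toFun := fun w => o (q (FreeGroup.of j)) • w + a j
      invFun := fun w => o (q (FreeGroup.of j))⁻¹ • (w - a j)
      left_inv := fun w => by simp only [add_sub_cancel_right, ho2]
      right_inv := fun w => by simp only [ho1, sub_add_cancel] }
  let ρ : FreeGroup (Fin k) →* Equiv.Perm W := FreeGroup.lift F
  have hF : ∀ j w, ρ (FreeGroup.of j) w = o (q (FreeGroup.of j)) • w + a j := by
    intro j w; simp only [ρ, FreeGroup.lift_apply_of]; rfl
  have hF' : ∀ j w, ρ (FreeGroup.of j)⁻¹ w = o (q (FreeGroup.of j))⁻¹ • (w - a j) := by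
    intro j w; rw [map_inv]; simp only [ρ, FreeGroup.lift_apply_of]; rfl
  have key : ∀ u w, ρ u w = o (q u) • w + ρ u 0 := by
    intro u
    induction u using FreeGroup.induction_on with
    | C1 => intro w; rw [map_one q, map_one o, one_smul, map_one ρ]; simp
    | of j => intro w; rw [hF, hF]; simp
    | inv_of j _ => intro w; rw [hF', hF', map_inv q, smul_sub, smul_sub, smul_zero]; abel
    | mul u v hu hv =>
      intro w
      rw [map_mul, Equiv.Perm.mul_apply, Equiv.Perm.mul_apply, hu, hv, hu (ρ v 0), map_mul, map_mul,
        mul_smul, smul_add, add_assoc]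
  refine ⟨fun u => ρ u 0, fun j => by simp [hF], fun u v => ?_⟩
  change ρ (u * v) 0 = _
  rw [map_mul, Equiv.Perm.mul_apply, key, add_comm]

theorem fox_deriv_one {W F : Type} [Group F] [AddCommGroup W] [Module (MonoidAlgebra ℤ G) W]
    (q : F →* G) (D : F → W)
    (hD : ∀ u v, D (u * v) = D u + MonoidAlgebra.of ℤ G (q u) • D v) : D 1 = 0 := by
  have := hD 1 1
  rw [mul_one, map_one, map_one, one_smul] at this
  simpa using this

theorem fox_deriv_inv {W F : Type} [Group F] [AddCommGroup W] [Module (MonoidAlgebra ℤ G) W]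
    (q : F →* G) (D : F → W)
    (hD : ∀ u v, D (u * v) = D u + MonoidAlgebra.of ℤ G (q u) • D v) (u : F) :
    MonoidAlgebra.of ℤ G (q u) • D u⁻¹ = - D u := by
  have := hD u u⁻¹
  rw [mul_inv_cancel, fox_deriv_one G q D hD] at this
  exact (neg_eq_of_add_eq_zero_right this.symm).symm

theorem deriv_normalClosure {W F : Type} [Group F] [AddCommGroup W] [Module (MonoidAlgebra ℤ G) W]
    (q : F →* G) (D : F → W)
    (hD : ∀ u v, D (u * v) = D u + MonoidAlgebra.of ℤ G (q u) • D v)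
    (rels : Set F) (hq : ∀ r ∈ rels, q r = 1) (hr : ∀ r ∈ rels, D r = 0) :
    ∀ u ∈ Subgroup.normalClosure rels, D u = 0 := by
  let K : Subgroup F :=
    { carrier := {u | q u = 1 ∧ D u = 0}
      one_mem' := ⟨map_one q, fox_deriv_one G q D hD⟩
      mul_mem' := by
        rintro u v ⟨h1, h2⟩ ⟨h3, h4⟩
        exact ⟨by rw [map_mul, h1, h3, mul_one], by rw [hD, h2, h4, smul_zero, add_zero]⟩
      inv_mem' := by
        rintro u ⟨h1, h2⟩
        refine ⟨by rw [map_inv, h1, inv_one], ?_⟩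
        have := fox_deriv_inv G q D hD u
        rwa [h1, map_one, one_smul, h2, neg_zero] at this }
  have hK : K.Normal := by
    constructor
    rintro u ⟨h1, h2⟩ g
    refine ⟨by simp [h1], ?_⟩
    rw [hD, hD, h2, smul_zero, add_zero, map_mul, h1, mul_one, fox_deriv_inv G q D hD,
      add_neg_cancel]
  intro u hu
  exact ((Subgroup.normalClosure_le_normal (N := K) fun r h => ⟨hq r h, hr r h⟩) hu).2

/-- The augmentation as an additive map. -/
noncomputable def epsHom (X : Type) : (X →₀ ℤ) →+ ℤ :=
  Finsupp.liftAddHom (fun _ => AddMonoidHom.id ℤ)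

theorem epsHom_single {X : Type} (x : X) (c : ℤ) : epsHom X (Finsupp.single x c) = c := by
  simp [epsHom]

theorem mem_deltaSet {Λ : Type} (H : Λ → Subgroup G) (v : cosetUnion G H →₀ ℤ) :
    v ∈ deltaSet G H ↔ epsHom _ v = 0 := Iff.rfl

theorem cosetShift_add {Λ : Type} (H : Λ → Subgroup G) (g : G) (v w : cosetUnion G H →₀ ℤ) :
    cosetShift G H g (v + w) = cosetShift G H g v + cosetShift G H g w :=
  Finsupp.mapDomain_add

theorem cosetShift_single {Λ : Type} (H : Λ → Subgroup G) (g : G) (x : cosetUnion G H) (c : ℤ) :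
    cosetShift G H g (Finsupp.single x c) = Finsupp.single ⟨x.1, g • x.2⟩ c :=
  Finsupp.mapDomain_single

theorem epsHom_shift {Λ : Type} (H : Λ → Subgroup G) (g : G) (v : cosetUnion G H →₀ ℤ) :
    epsHom _ (cosetShift G H g v) = epsHom _ v := by
  induction v using Finsupp.induction_linear with
  | zero => simp [cosetShift]
  | add f h hf hh => rw [cosetShift_add, map_add, map_add, hf, hh]
  | single x c => rw [cosetShift_single, epsHom_single, epsHom_single]

theorem exists_presentation {Λ : Type} (H : Λ → Subgroup G)
    (hΛ : Finite Λ) (hH : ∀ α : Λ, (H α).FG) (hG : IsFinitelyPresented G)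
    {M : Type} [AddCommGroup M] [Module (MonoidAlgebra ℤ G) M]
    (E : ((cosetUnion G H) →₀ ℤ) ≃+ M)
    (hE : ∀ g v, E (cosetShift G H g v) = MonoidAlgebra.of ℤ G g • E v) :
    ∃ (B0 : Type) (_ : Finite B0) (p : (B0 →₀ MonoidAlgebra ℤ G) →ₗ[MonoidAlgebra ℤ G] M),
      (LinearMap.ker p).FG ∧ ∀ v, E v ∈ LinearMap.range p ↔ v ∈ deltaSet G H := by
  classical
  rcases isEmpty_or_nonempty Λ with hemp | ⟨⟨α0⟩⟩
  · refine ⟨Fin 0, inferInstance, 0, ?_, fun v => ?_⟩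
    · have : LinearMap.ker (0 : (Fin 0 →₀ MonoidAlgebra ℤ G) →ₗ[MonoidAlgebra ℤ G] M) = ⊥ :=
        Subsingleton.elim _ _
      rw [this]; exact Submodule.fg_bot
    · have : v = 0 := Subsingleton.elim _ _
      subst this
      rw [mem_deltaSet]
      simp
  obtain ⟨k, rels, hfin, ⟨e⟩⟩ := hG
  let q : FreeGroup (Fin k) →* G := e.symm.toMonoidHom.comp (PresentedGroup.mk rels)
  have hq1 : ∀ u, q u = 1 ↔ u ∈ Subgroup.normalClosure rels := by
    intro u
    rw [← PresentedGroup.mk_eq_one_iff]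
    simp [q]
  have hqs : Function.Surjective q :=
    e.symm.surjective.comp (PresentedGroup.mk_surjective rels)
  choose l hl using hqs
  choose S hS using hH
  let o := MonoidAlgebra.of ℤ G
  let V := (Fin k ⊕ Λ) →₀ MonoidAlgebra ℤ G
  let bb : Λ → V := fun α => Finsupp.single (Sum.inr α) 1
  obtain ⟨D, hD1, hD⟩ := exists_deriv G (W := V) q (fun j => Finsupp.single (Sum.inl j) 1)
  let c : Λ → M := fun α => E (Finsupp.single ⟨α, ((1 : G) : G ⧸ H α)⟩ 1)
  have hc : ∀ α (g : G), o g • c α = E (Finsupp.single ⟨α, (g : G ⧸ H α)⟩ 1) := by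
    intro α g
    rw [← hE, cosetShift_single]
    congr 3
    change ((g * 1 : G) : G ⧸ H α) = g
    rw [mul_one]
  let p : V →ₗ[MonoidAlgebra ℤ G] M := Finsupp.linearCombination _
    (Sum.elim (fun j => o (q (FreeGroup.of j)) • c α0 - c α0) (fun α => c α - c α0))
  have hpa : ∀ j, p (Finsupp.single (Sum.inl j) 1) = o (q (FreeGroup.of j)) • c α0 - c α0 := by
    intro j; exact (Finsupp.linearCombination_single _ _ _).trans (one_smul _ _)
  have hpb : ∀ α, p (bb α) = c α - c α0 := by
    intro α; exact (Finsupp.linearCombination_single _ _ _).trans (one_smul _ _)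
  have hpD : ∀ u, p (D u) = o (q u) • c α0 - c α0 := by
    intro u
    induction u using FreeGroup.induction_on with
    | C1 => rw [fox_deriv_one G q D hD, map_one q, map_one o, one_smul, sub_self, map_zero]
    | of j => rw [hD1, hpa]
    | inv_of j h =>
      have h1 := congrArg p (fox_deriv_inv G q D hD (FreeGroup.of j))
      rw [map_smul, map_neg, h] at h1
      have h2 := congrArg (fun x => o (q (FreeGroup.of j)⁻¹) • x) h1
      simp only [← mul_smul] at h2
      rw [← map_mul, ← map_mul, inv_mul_cancel, map_one, map_one, one_smul] at h2
      rw [h2, smul_neg, smul_sub, ← mul_smul, ← map_mul, ← map_mul, inv_mul_cancel, map_one,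
        map_one, one_smul]
      abel
    | mul u v hu hv =>
      rw [hD, map_add, map_smul, hu, hv, map_mul, map_mul, mul_smul, smul_sub]
      abel
  let Ns : Set V := D '' rels ∪
    (⋃ α, (fun h => D (l h) + o h • bb α - bb α) '' (S α : Set G)) ∪ {bb α0}
  have hNs : Ns.Finite := by
    refine ((hfin.image _).union (Set.finite_iUnion fun α => ?_)).union (Set.finite_singleton _)
    exact (Finset.finite_toSet _).image _
  let N : Submodule (MonoidAlgebra ℤ G) V := Submodule.span _ Ns
  have hNp : N ≤ LinearMap.ker p := by
    refine Submodule.span_le.2 ?_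
    rintro v ((⟨r, hr, rfl⟩ | hv) | hv)
    · change p (D r) = 0
      rw [hpD, (hq1 r).2 (Subgroup.subset_normalClosure hr), map_one, one_smul, sub_self]
    · obtain ⟨α, h, hh, rfl⟩ := Set.mem_iUnion.1 hv
      change p (D (l h) + o h • bb α - bb α) = 0
      have hmem : h ∈ H α := by
        rw [← hS α]; exact Subgroup.subset_closure hh
      have : o h • c α = c α := by
        rw [hc]
        congr 3
        exact QuotientGroup.eq.2 (by simpa using hmem)
      rw [map_sub, map_add, map_smul, hpD, hl, hpb, smul_sub, this]
      abel
    · rw [Set.mem_singleton_iff.1 hv]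
      change p (bb α0) = 0
      rw [hpb, sub_self]
  let mk := N.mkQ
  have hmk : ∀ v ∈ Ns, mk v = 0 := by
    intro v hv
    exact (Submodule.Quotient.mk_eq_zero N).2 (Submodule.subset_span hv)
  have hb0 : mk (bb α0) = 0 := hmk _ (Or.inr rfl)
  let D' : G → V ⧸ N := fun g => mk (D (l g))
  have hδ : ∀ u v, mk (D (u * v)) = mk (D u) + o (q u) • mk (D v) := by
    intro u v; rw [hD, map_add, map_smul]
  have hD'q : ∀ u, D' (q u) = mk (D u) := by
    intro u
    have h1 : u⁻¹ * l (q u) ∈ Subgroup.normalClosure rels := by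
      rw [← hq1, map_mul, hl, map_inv, inv_mul_cancel]
    have h2 : mk (D (u⁻¹ * l (q u))) = 0 := deriv_normalClosure G q (fun u => mk (D u)) hδ rels
      (fun r hr => (hq1 r).2 (Subgroup.subset_normalClosure hr))
      (fun r hr => hmk _ (Or.inl (Or.inl ⟨r, hr, rfl⟩))) _ h1
    have h3 := hδ u (u⁻¹ * l (q u))
    rw [mul_inv_cancel_left] at h3
    change mk (D (l (q u))) = _
    rw [h3, h2, smul_zero, add_zero]
  have hD' : ∀ g h, D' (g * h) = D' g + o g • D' h := by
    intro g h
    have := hδ (l g) (l h)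
    rw [← hD'q, map_mul, hl, hl] at this
    exact this
  have hD'1 : D' 1 = 0 := fox_deriv_one G (MonoidHom.id G) D' hD'
  have hstab : ∀ α, ∀ h ∈ H α, D' h + o h • mk (bb α) = mk (bb α) := by
    intro α h hh
    rw [← hS α] at hh
    induction hh using Subgroup.closure_induction with
    | mem x hx =>
      have := hmk (D (l x) + o x • bb α - bb α)
        (Or.inl (Or.inr (Set.mem_iUnion.2 ⟨α, x, hx, rfl⟩)))
      rw [map_sub, map_add, map_smul, sub_eq_zero] at this
      exact this
    | one => rw [hD'1, map_one, one_smul, zero_add]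
    | mul x y _ _ hx hy =>
      rw [hD', map_mul, mul_smul, add_assoc, ← smul_add, hy, hx]
    | inv x _ hx =>
      have h1 := hD' x⁻¹ x
      rw [inv_mul_cancel, hD'1] at h1
      have h2 : o x⁻¹ • o x • mk (bb α) = mk (bb α) := by
        rw [← mul_smul, ← map_mul, inv_mul_cancel, map_one, one_smul]
      have h3 := congrArg (fun w => o x⁻¹ • w) hx
      simp only [smul_add] at h3
      rw [h2] at h3
      rw [← h3, ← add_assoc, ← h1, zero_add]
  let t : cosetUnion G H → V ⧸ N := fun x => D' x.2.out + o x.2.out • mk (bb x.1)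
  have ht : ∀ α (g : G), t ⟨α, (g : G ⧸ H α)⟩ = D' g + o g • mk (bb α) := by
    intro α g
    obtain ⟨h, hh⟩ := QuotientGroup.mk_out_eq_mul (H α) g
    change D' ((g : G ⧸ H α).out) + o ((g : G ⧸ H α).out) • mk (bb α) = _
    rw [hh, hD', map_mul, mul_smul, add_assoc, ← smul_add, hstab α h h.2]
  let s : (cosetUnion G H →₀ ℤ) →+ V ⧸ N := Finsupp.liftAddHom (fun x => zmultiplesHom _ (t x))
  have hs : ∀ x c, s (Finsupp.single x c) = c • t x := by
    intro x c; simp [s]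
  have hts : ∀ (g : G) (x : cosetUnion G H), t ⟨x.1, g • x.2⟩ = D' g + o g • t x := by
    rintro g ⟨α, x⟩
    obtain ⟨y, rfl⟩ := QuotientGroup.mk_surjective x
    change t ⟨α, ((g * y : G) : G ⧸ H α)⟩ = _
    rw [ht, ht, hD', map_mul, mul_smul, smul_add, add_assoc]
  have hss : ∀ (g : G) v, s (cosetShift G H g v) = o g • s v + epsHom _ v • D' g := by
    intro g v
    induction v using Finsupp.induction_linear with
    | zero => simp [cosetShift]
    | add f h hf hh =>
      rw [cosetShift_add, map_add, hf, hh, map_add, map_add, smul_add, add_smul]; abel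
    | single x c =>
      rw [cosetShift_single, hs, hs, epsHom_single, hts, smul_add, smul_comm c (o g), add_comm]
  have hEs : ∀ (g : G) m, E.symm (o g • m) = cosetShift G H g (E.symm m) := by
    intro g m
    apply E.injective
    rw [hE]; simp [o]
  have hEc : ∀ α, E.symm (c α) = Finsupp.single ⟨α, ((1 : G) : G ⧸ H α)⟩ 1 := by
    intro α; simp [c]
  have heps0 : ∀ b, epsHom _ (E.symm (p (Finsupp.single b 1))) = 0 := by
    rintro (j | α)
    · rw [hpa, map_sub, hEs, map_sub, epsHom_shift, sub_self]
    · rw [show Finsupp.single (Sum.inr α) 1 = bb α from rfl, hpb, map_sub, map_sub, hEc, hEc,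
        epsHom_single, epsHom_single, sub_self]
  have hsc : ∀ α, s (E.symm (c α)) = mk (bb α) := by
    intro α
    rw [hEc, hs, ht, hD'1, map_one, one_smul, one_smul, zero_add]
  have hs0 : ∀ b, s (E.symm (p (Finsupp.single b 1))) = mk (Finsupp.single b 1) := by
    rintro (j | α)
    · rw [hpa, map_sub, hEs, map_sub, hss, hsc, hb0, smul_zero, zero_add, sub_zero, hEc,
        epsHom_single, one_smul, hD'q, hD1]
    · rw [show Finsupp.single (Sum.inr α) 1 = bb α from rfl, hpb, map_sub, map_sub, hsc, hsc, hb0,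
        sub_zero]
  have hsing : ∀ (g : G) (b : Fin k ⊕ Λ) (z : ℤ),
      (Finsupp.single b (MonoidAlgebra.single g z) : V) = z • o g • Finsupp.single b 1 := by
    intro g b z
    rw [Finsupp.smul_single, Finsupp.smul_single]
    congr 1
    rw [smul_eq_mul, mul_one]
    simp [o]
  have hepsx : ∀ x, epsHom _ (E.symm (p (eqv G _ x))) = 0 := by
    intro x
    induction x using Finsupp.induction_linear with
    | zero => simp
    | add f h hf hh => rw [map_add, map_add, map_add, map_add, hf, hh, add_zero]
    | single y z =>
      obtain ⟨g, b⟩ := y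
      rw [eqv_single, hsing, map_zsmul, map_zsmul, map_zsmul, map_smul, hEs, epsHom_shift, heps0,
        smul_zero]
  have hsx : ∀ x, s (E.symm (p (eqv G _ x))) = mk (eqv G _ x) := by
    intro x
    induction x using Finsupp.induction_linear with
    | zero => simp
    | add f h hf hh => rw [map_add, map_add, map_add, map_add, hf, hh, map_add]
    | single y z =>
      obtain ⟨g, b⟩ := y
      rw [eqv_single, hsing, map_zsmul, map_zsmul, map_zsmul, map_smul, hEs, hss, heps0,
        zero_smul, add_zero, hs0, map_zsmul, map_smul]
  have hker : LinearMap.ker p = N := by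
    refine le_antisymm (fun v hv => ?_) hNp
    have h1 := hsx ((eqv G _).symm v)
    rw [AddEquiv.apply_symm_apply, LinearMap.mem_ker.1 hv, map_zero, map_zero] at h1
    exact (Submodule.Quotient.mk_eq_zero N).1 h1.symm
  have hcov : ∀ v, E v - epsHom _ v • c α0 ∈ LinearMap.range p := by
    intro v
    induction v using Finsupp.induction_linear with
    | zero => simp
    | add f h hf hh =>
      have := Submodule.add_mem _ hf hh
      rw [map_add, map_add, add_smul]
      convert this using 1
      abel
    | single x z =>
      obtain ⟨α, x⟩ := x
      obtain ⟨g, rfl⟩ := QuotientGroup.mk_surjective x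
      have h1 : E (Finsupp.single ⟨α, (g : G ⧸ H α)⟩ z) = z • o g • c α := by
        rw [hc, ← map_zsmul, Finsupp.smul_single]; simp
      refine ⟨z • (D (l g) + o g • bb α), ?_⟩
      rw [map_zsmul, map_add, hpD, hl, map_smul, hpb, epsHom_single]
      change _ = E (Finsupp.single ⟨α, (g : G ⧸ H α)⟩ z) - _
      rw [h1, ← smul_sub, smul_sub (o g)]
      congr 1
      abel
  refine ⟨Fin k ⊕ Λ, inferInstance, p, ?_, fun v => ?_⟩
  · rw [hker]
    exact Submodule.fg_span hNs
  · rw [mem_deltaSet]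
    constructor
    · rintro ⟨w, hw⟩
      have := hepsx ((eqv G _).symm w)
      rwa [AddEquiv.apply_symm_apply, hw, AddEquiv.symm_apply_apply] at this
    · intro hv
      have := hcov v
      rwa [hv, zero_smul, sub_zero] at this

/-- The permutation representation on `⊕_α ℤ[G/H_α]`. -/
noncomputable def cosetRep {Λ : Type} (H : Λ → Subgroup G) :
    Representation ℤ G (cosetUnion G H →₀ ℤ) where
  toFun g := Finsupp.lmapDomain ℤ ℤ
    (fun q : cosetUnion G H => (⟨q.1, g • q.2⟩ : cosetUnion G H))
  map_one' := by ext; simp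
  map_mul' x y := by ext; simp [mul_smul]

/-- Lemma on relative finiteness:  Let `{H_α}_{α ∈ Λ}` be a family of
subgroups of `G` and `Δ` the augmentation kernel.  Suppose (1) `Λ` is finite, (2) each
`H_α` is finitely generated, (3) `G` is finitely presented, and (4)
`Tor_i^{ℤ[G]} (Δ, ∏ ℤ[G]) = 0` for `1 ≤ i ≤ n-1` and all direct products — expressed
here by saying that for every free `ℤ[G]`-resolution of `Δ` and every index type `ι`,
the complex obtained by tensoring with `∏_ι ℤ[G]` over `ℤ[G]` has vanishing homology
in degrees `1, …, n-1`.  Then `Δ` is of type `FP^n` over `ℤ[G]`: it admits a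
resolution `P_n → ⋯ → P_0 → Δ → 0` by finitely generated free `ℤ[G]`-modules
(equivalently, finitely generated projectives). -/
theorem augmentation_kernel_FPn
    {Λ : Type} (H : Λ → Subgroup G)
    (hΛ : Finite Λ)
    (hH : ∀ α : Λ, (H α).FG)
    (hG : IsFinitelyPresented G)
    (n : ℕ)
    (hTor : ∀ (Bs : ℕ → Type)
      (d : ∀ i : ℕ, ((G × Bs (i + 1)) →₀ ℤ) →ₗ[ℤ] ((G × Bs i) →₀ ℤ))
      (π : ((G × Bs 0) →₀ ℤ) →ₗ[ℤ] ((cosetUnion G H) →₀ ℤ)),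
      (∀ (i : ℕ) (g : G) (x : (G × Bs (i + 1)) →₀ ℤ),
        d i (freeShift G g x) = freeShift G g (d i x)) →
      (∀ (g : G) (x : (G × Bs 0) →₀ ℤ), π (freeShift G g x) = cosetShift G H g (π x)) →
      Set.range π = deltaSet G H →
      (∀ x : (G × Bs 0) →₀ ℤ, π x = 0 ↔ ∃ y, d 0 y = x) →
      (∀ (i : ℕ) (x : (G × Bs (i + 1)) →₀ ℤ), d i x = 0 ↔ ∃ y, d (i + 1) y = x) →
      ∀ (ι : Type) (i : ℕ), i + 2 ≤ n →
        ∀ y : Bs (i + 1) →₀ (ι → MonoidAlgebra ℤ G),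
          tensorProd G (d i) y = 0 → ∃ z, tensorProd G (d (i + 1)) z = y) :
    ∃ (m : ℕ → ℕ)
      (d : ∀ i : ℕ, ((G × Fin (m (i + 1))) →₀ ℤ) →ₗ[ℤ] ((G × Fin (m i)) →₀ ℤ))
      (π : ((G × Fin (m 0)) →₀ ℤ) →ₗ[ℤ] ((cosetUnion G H) →₀ ℤ)),
      (∀ (i : ℕ) (g : G) (x : (G × Fin (m (i + 1))) →₀ ℤ),
        d i (freeShift G g x) = freeShift G g (d i x)) ∧
      (∀ (g : G) (x : (G × Fin (m 0)) →₀ ℤ), π (freeShift G g x) = cosetShift G H g (π x)) ∧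
      Set.range π = deltaSet G H ∧
      (1 ≤ n → ∀ x : (G × Fin (m 0)) →₀ ℤ, π x = 0 ↔ ∃ y, d 0 y = x) ∧
      (∀ i : ℕ, i + 2 ≤ n →
        ∀ x : (G × Fin (m (i + 1))) →₀ ℤ, d i x = 0 ↔ ∃ y, d (i + 1) y = x) := by
  let E := (cosetRep G H).asModuleEquiv.symm.toAddEquiv
  have hE : ∀ g v, E (cosetShift G H g v) = MonoidAlgebra.of ℤ G g • E v := fun g v =>
    Representation.asModuleEquiv_symm_map_rho (cosetRep G H) g v
  obtain ⟨B0, hB0, p, hk, hp⟩ := exists_presentation G H hΛ hH hG E hE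
  exact FPn_of_presentation G H n E hE p hk hp hTor
end

section
/- Let G be a group, {H_α}_{α∈Λ} a family of subgroups with Λ finite, each H_α finitely generated, and G finitely presented, and let Δ = ker(⊕_{α∈Λ} ℤ[G/H_α] → ℤ). Suppose there exists a filtration {X_β} of EG(Λ) of finite n-type relative to {H_α} such that the directed system {H̃_m(X_β)} of reduced simplicial homology groups is essentially trivial for all finite m ≤ n. Then Δ is of type FP^{n−1} over ℤ[G]. -/
open scoped BigOperators

variable (G : Type) [Group G]

/-- The simplicial boundary map on the (unnormalized) chains of the simplicial set
`S_• (X)` whose `m`-simplices are the tuples `X^{m+1}`: the alternating sum of the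
face (vertex-deletion) maps. -/
noncomputable def sBoundary (X : Type) (m : ℕ) (c : (Fin (m + 2) → X) →₀ ℤ) :
    (Fin (m + 1) → X) →₀ ℤ :=
  c.sum fun v k =>
    ∑ i : Fin (m + 2), ((-1 : ℤ) ^ (i : ℕ) * k) • Finsupp.single (v ∘ i.succAbove) 1

/-- The sub-simplicial set `X_∅ = p⁻¹ (⊔_α BH_α) ⊆ EG(Λ) = S_•(Λ × G)`: the
simplices lying in the `G`-orbit of some `S_•(H_α)` inside the `α`-component. -/
def baseSimplices {Λ : Type} (H : Λ → Subgroup G) (m : ℕ) : Set (Fin (m + 1) → Λ × G) :=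
  {v | ∃ α : Λ, (∀ i, (v i).1 = α) ∧ ∀ i j, ((v i).2)⁻¹ * (v j).2 ∈ H α}


/-! ### Chains on a `G`-set as a module over the group ring -/

/-- The group ring. -/
abbrev GRing : Type := MonoidAlgebra ℤ G

/-- Translation on chains, as a monoid homomorphism. -/
noncomputable def chShift (S : Type) [MulAction G S] : G →* Module.End ℤ (S →₀ ℤ) where
  toFun g := Finsupp.lmapDomain ℤ ℤ (fun s => g • s)
  map_one' := by
    ext s : 2
    simp [Finsupp.mapDomain_single]
  map_mul' g h := by
    ext s : 2
    simp [mul_smul, Finsupp.mapDomain_single]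

/-- The group ring module structure on chains. -/
@[reducible] noncomputable def chModule (S : Type) [MulAction G S] :
    Module (GRing G) (S →₀ ℤ) :=
  Module.compHom (S →₀ ℤ) (MonoidAlgebra.lift ℤ (Module.End ℤ (S →₀ ℤ)) G (chShift G S)).toRingHom

attribute [local instance] chModule

/-- The element of the group ring given by a group element. -/
noncomputable abbrev gr (g : G) : GRing G := MonoidAlgebra.of ℤ G g

theorem gr_smul (S : Type) [MulAction G S] (g : G) (x : S →₀ ℤ) :
    gr G g • x = Finsupp.mapDomain (fun s => g • s) x := by
  change (MonoidAlgebra.lift ℤ (Module.End ℤ (S →₀ ℤ)) G (chShift G S)) (MonoidAlgebra.of ℤ G g) x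
    = _
  rw [MonoidAlgebra.lift_of]
  rfl

theorem gr_smul_single (S : Type) [MulAction G S] (g : G) (s : S) (k : ℤ) :
    gr G g • (Finsupp.single s k : S →₀ ℤ) = Finsupp.single (g • s) k := by
  rw [gr_smul, Finsupp.mapDomain_single]

/-- an additive map commuting with the group commutes with the group ring -/
theorem map_ring_smul {M N : Type} [AddCommGroup M] [AddCommGroup N] [Module (GRing G) M]
    [Module (GRing G) N] (f : M →+ N) (hf : ∀ g x, f (gr G g • x) = gr G g • f x)
    (r : GRing G) (x : M) : f (r • x) = r • f x := by
  induction r using MonoidAlgebra.induction_on with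
  | of g => exact hf g x
  | add a b ha hb => rw [add_smul, add_smul, map_add, ha, hb]
  | smul k a ha =>
    rw [smul_assoc, smul_assoc, map_zsmul, ha]

/-- Linear map over the group ring from an equivariant additive map. -/
def mkLin {M N : Type} [AddCommGroup M] [AddCommGroup N] [Module (GRing G) M]
    [Module (GRing G) N] (f : M →+ N) (hf : ∀ g x, f (gr G g • x) = gr G g • f x) :
    M →ₗ[GRing G] N where
  toFun := f
  map_add' := map_add f
  map_smul' r x := map_ring_smul G f hf r x

theorem smul_zsmul_aux {N : Type} [AddCommGroup N] [Module (GRing G) N] (r : GRing G) (k : ℤ)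
    (x : N) : r • (k • x) = k • (r • x) :=
  map_zsmul (DistribSMul.toAddMonoidHom N r) k x

/-- Define a linear map on simplices. -/
noncomputable def liftS {S N : Type} [MulAction G S] [AddCommGroup N] [Module (GRing G) N]
    (φ : S → N) (hφ : ∀ g s, φ (g • s) = gr G g • φ s) : (S →₀ ℤ) →ₗ[GRing G] N :=
  mkLin G (Finsupp.liftAddHom (fun s => (zmultiplesHom N (φ s)))) (by
    intro g x
    induction x using Finsupp.induction_linear with
    | zero => simp
    | add a b ha hb => rw [smul_add, map_add, map_add, ha, hb, smul_add]
    | single s k =>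
      rw [gr_smul_single]
      simp only [Finsupp.liftAddHom_apply_single, zmultiplesHom_apply, hφ]
      exact (smul_zsmul_aux G (gr G g) k (φ s)).symm)

theorem liftS_single {S N : Type} [MulAction G S] [AddCommGroup N] [Module (GRing G) N]
    (φ : S → N) (hφ : ∀ g s, φ (g • s) = gr G g • φ s) (s : S) (k : ℤ) :
    liftS G φ hφ (Finsupp.single s k) = k • φ s := by
  change (Finsupp.liftAddHom (fun s => (zmultiplesHom N (φ s)))) (Finsupp.single s k) = _
  simp

theorem liftS_apply {S N : Type} [MulAction G S] [AddCommGroup N] [Module (GRing G) N]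
    (φ : S → N) (hφ : ∀ g s, φ (g • s) = gr G g • φ s) (x : S →₀ ℤ) :
    liftS G φ hφ x = x.sum (fun s k => k • φ s) := by
  rfl

theorem lin_ext {S N : Type} [MulAction G S] [AddCommGroup N] [Module (GRing G) N]
    (f f' : (S →₀ ℤ) →ₗ[GRing G] N)
    (h : ∀ s, f (Finsupp.single s 1) = f' (Finsupp.single s 1)) : f = f' := by
  have : f.toAddMonoidHom = f'.toAddMonoidHom := by
    ext s
    exact h s
  ext x
  exact DFunLike.congr_fun this x

theorem ch_projective {S : Type} [MulAction G S] (ρ : S → G)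
    (hρ : ∀ g s, ρ (g • s) = g * ρ s) : Module.Projective (GRing G) (S →₀ ℤ) := by
  refine Module.Projective.of_lifting_property'' fun f hf => ?_
  choose φ hφ using fun s : S => hf (Finsupp.single s 1)
  refine ⟨liftS G (fun s => gr G (ρ s) • φ ((ρ s)⁻¹ • s)) ?_, ?_⟩
  · intro g s
    simp only [hρ, mul_inv_rev, mul_smul, inv_smul_smul, map_mul]
  · apply lin_ext
    intro s
    simp only [LinearMap.comp_apply, liftS_single, one_smul, map_smul, hφ, gr_smul_single,
      smul_inv_smul, LinearMap.id_apply]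

/-- The action on a free `G`-set. -/
@[reducible] def actFree (B : Type) : MulAction G (G × B) where
  smul g p := (g * p.1, p.2)
  one_smul p := by
    change (1 * p.1, p.2) = p
    simp
  mul_smul g h p := by
    change (g * h * p.1, p.2) = (g * (h * p.1), p.2)
    rw [mul_assoc]

attribute [local instance] actFree

theorem free_projective (B : Type) : Module.Projective (GRing G) ((G × B) →₀ ℤ) :=
  ch_projective G (fun p => p.1) (fun _ _ => rfl)

/-- Map out of a free module. -/
noncomputable def freeLift {B N : Type} [AddCommGroup N] [Module (GRing G) N] (k : B → N) :
    ((G × B) →₀ ℤ) →ₗ[GRing G] N :=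
  liftS G (fun p => gr G p.1 • k p.2) (by
    intro g s
    rw [← mul_smul, ← map_mul]
    rfl)

theorem freeLift_single {B N : Type} [AddCommGroup N] [Module (GRing G) N] (k : B → N) (g : G)
    (b : B) : freeLift G k (Finsupp.single (g, b) 1) = gr G g • k b := by
  rw [freeLift, liftS_single, one_smul]

theorem ch_span {S : Type} [MulAction G S] (N : Submodule (GRing G) (S →₀ ℤ))
    (h : ∀ s, Finsupp.single s 1 ∈ N) (x : S →₀ ℤ) : x ∈ N := by
  induction x using Finsupp.induction_linear with
  | zero => exact zero_mem _
  | add a b ha hb => exact add_mem ha hb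
  | single s k =>
    have : (Finsupp.single s k : S →₀ ℤ) = k • Finsupp.single s 1 := by simp
    rw [this]
    exact zsmul_mem (h s) k

theorem free_fg (m : ℕ) : (⊤ : Submodule (GRing G) ((G × Fin m) →₀ ℤ)).FG := by
  refine Submodule.fg_def.2 ⟨Set.range fun b : Fin m => Finsupp.single (1, b) 1,
    Set.finite_range _, ?_⟩
  rw [eq_top_iff]
  rintro x -
  apply ch_span G _ _ x
  rintro ⟨g, b⟩
  have := Submodule.smul_mem (Submodule.span (GRing G)
    (Set.range fun b : Fin m => (Finsupp.single ((1 : G), b) (1 : ℤ)))) (gr G g)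
    (Submodule.subset_span ⟨b, rfl⟩)
  rw [gr_smul_single] at this
  have e : (g • ((1 : G), b) : G × Fin m) = (g, b) := by
    change (g * 1, b) = _
    rw [mul_one]
  rwa [e] at this

theorem exists_cover_s13 {P : Type} [AddCommGroup P] [Module (GRing G) P]
    (K : Submodule (GRing G) P) (hK : K.FG) :
    ∃ (m : ℕ) (d : ((G × Fin m) →₀ ℤ) →ₗ[GRing G] P), LinearMap.range d = K := by
  obtain ⟨m, k, hk⟩ := Submodule.fg_iff_exists_fin_generating_family.1 hK
  refine ⟨m, freeLift G k, le_antisymm ?_ ?_⟩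
  · rintro _ ⟨x, rfl⟩
    change x ∈ K.comap (freeLift G k)
    apply ch_span
    rintro ⟨g, b⟩
    rw [Submodule.mem_comap, freeLift_single, ← hk]
    exact Submodule.smul_mem _ _ (Submodule.subset_span ⟨b, rfl⟩)
  · rw [← hk, Submodule.span_le]
    rintro _ ⟨b, rfl⟩
    refine ⟨Finsupp.single (1, b) 1, ?_⟩
    rw [freeLift_single, gr, map_one, one_smul]

/-- Lift a map from a projective module through a map whose range contains the image. -/
theorem exists_lift {P Q M : Type} [AddCommGroup P] [Module (GRing G) P] [AddCommGroup Q]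
    [Module (GRing G) Q] [AddCommGroup M] [Module (GRing G) M]
    (hP : Module.Projective (GRing G) P) (d : Q →ₗ[GRing G] M) (f : P →ₗ[GRing G] M)
    (h : LinearMap.range f ≤ LinearMap.range d) : ∃ l : P →ₗ[GRing G] Q, d ∘ₗ l = f := by
  obtain ⟨l, hl⟩ := Module.projective_lifting_property d.rangeRestrict
    (f.codRestrict (LinearMap.range d) (fun x => h ⟨x, rfl⟩)) d.surjective_rangeRestrict
  refine ⟨l, ?_⟩
  ext x
  have := congrArg Subtype.val (LinearMap.congr_fun hl x)
  exact this

/-! ### The inductive construction -/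

/-- The invariant of the construction. -/
def Good {P E : Type} [AddCommGroup P] [Module (GRing G) P] [AddCommGroup E] [Module (GRing G) E]
    (A : ℕ → Submodule (GRing G) E) (Z : Submodule (GRing G) E) (K : Submodule (GRing G) P) :
    Prop :=
  K.FG ∧ ∃ (f : P →ₗ[GRing G] E) (g : E →ₗ[GRing G] P) (θ : P →ₗ[GRing G] P) (k : ℕ),
    (∀ x, f x ∈ A k) ∧ (∀ x ∈ K, f x ∈ Z) ∧ (∀ x ∈ Z, g x ∈ K) ∧ (∀ x, θ x ∈ K) ∧
    (∀ x ∈ K, θ x = x - g (f x)) ∧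
    (∀ (m : ℕ) (d : ((G × Fin m) →₀ ℤ) →ₗ[GRing G] P), LinearMap.range d = K →
      ∃ h : P →ₗ[GRing G] ((G × Fin m) →₀ ℤ), d ∘ₗ h = θ)

theorem good_step {P E E' E'' : Type} [AddCommGroup P] [Module (GRing G) P]
    [AddCommGroup E] [Module (GRing G) E] [AddCommGroup E'] [Module (GRing G) E']
    [AddCommGroup E''] [Module (GRing G) E'']
    (hE' : Module.Projective (GRing G) E')
    (A : ℕ → Submodule (GRing G) E) (Z : Submodule (GRing G) E)
    (A' : ℕ → Submodule (GRing G) E') (A'' : ℕ → Submodule (GRing G) E'')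
    (δ : E' →ₗ[GRing G] E) (δ' : E'' →ₗ[GRing G] E')
    (hδδ : ∀ x, δ (δ' x) = 0) (hδZ : ∀ x, δ x ∈ Z)
    (hex : ∀ k, ∀ x ∈ A k, x ∈ Z → ∃ y ∈ A' (k + 1), δ y = x)
    (hex' : ∀ k, ∀ x ∈ A' k, δ x = 0 → ∃ y ∈ A'' (k + 1), δ' y = x)
    (hfg : ∀ k, (A'' k).FG)
    (K : Submodule (GRing G) P) (m : ℕ) (d : ((G × Fin m) →₀ ℤ) →ₗ[GRing G] P)
    (hd : LinearMap.range d = K)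
    (hK : Good G A Z K) : Good G A' (LinearMap.ker δ) (LinearMap.ker d) := by
  obtain ⟨-, f, g, θ, k, hfA, hfZ, hgK, hθ, hθK, hlift⟩ := hK
  have hdK : ∀ x, d x ∈ K := fun x => hd ▸ ⟨x, rfl⟩
  have hfree := free_projective G (Fin m)
  -- the map to the complex
  obtain ⟨f', hf'⟩ := exists_lift G hfree (δ ∘ₗ (A' (k + 1)).subtype) (f ∘ₗ d) (by
    rintro _ ⟨x, rfl⟩
    obtain ⟨y, hy, hyx⟩ := hex k (f (d x)) (hfA _) (hfZ _ (hdK x))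
    exact ⟨⟨y, hy⟩, hyx⟩)
  have hf'1 : ∀ x, δ (f' x) = f (d x) := fun x => LinearMap.congr_fun hf' x
  obtain ⟨g', hg'⟩ := exists_lift G hE' d (g ∘ₗ δ) (by
    rintro _ ⟨x, rfl⟩
    rw [hd]
    exact hgK _ (hδZ x))
  have hg'1 : ∀ x, d (g' x) = g (δ x) := fun x => LinearMap.congr_fun hg' x
  obtain ⟨h, hh⟩ := hlift m d hd
  have hh1 : ∀ x, d (h x) = θ x := fun x => LinearMap.congr_fun hh x
  let F : ((G × Fin m) →₀ ℤ) →ₗ[GRing G] E' := (A' (k + 1)).subtype ∘ₗ f'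
  have hF : ∀ x, F x = f' x := fun x => rfl
  let θ' : ((G × Fin m) →₀ ℤ) →ₗ[GRing G] ((G × Fin m) →₀ ℤ) :=
    LinearMap.id - g' ∘ₗ F - h ∘ₗ d
  have hθ' : ∀ x, θ' x = x - g' (f' x) - h (d x) := fun x => rfl
  have hθ'0 : ∀ x, d (θ' x) = 0 := by
    intro x
    rw [hθ', map_sub, map_sub, hg'1, hh1, hf'1, hθK _ (hdK x)]
    abel
  refine ⟨?_, F, g', θ', k + 1, fun x => (f' x).2, ?_, ?_, ?_, ?_, ?_⟩
  · have e : LinearMap.ker d = LinearMap.range θ' ⊔ (A'' (k + 2)).map (g' ∘ₗ δ') := by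
      apply le_antisymm
      · intro x hx
        rw [LinearMap.mem_ker] at hx
        obtain ⟨y, hy, hyx⟩ := hex' (k + 1) (f' x) (f' x).2 (by rw [hf'1, hx, map_zero])
        have : x = θ' x + g' (δ' y) := by
          rw [hθ', hyx, hx, map_zero]
          abel
        rw [this]
        exact Submodule.add_mem_sup ⟨x, rfl⟩ ⟨y, hy, rfl⟩
      · apply sup_le
        · rintro _ ⟨x, rfl⟩
          exact hθ'0 x
        · rintro _ ⟨y, -, rfl⟩
          change d (g' (δ' y)) = 0
          rw [hg'1, hδδ, map_zero]
    rw [e]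
    refine Submodule.FG.sup ?_ ((hfg _).map _)
    rw [LinearMap.range_eq_map]
    exact (free_fg G m).map _
  · intro x hx
    rw [LinearMap.mem_ker] at hx ⊢
    rw [hF, hf'1, hx, map_zero]
  · intro x hx
    rw [LinearMap.mem_ker] at hx ⊢
    rw [hg'1, hx, map_zero]
  · exact hθ'0
  · intro x hx
    rw [LinearMap.mem_ker] at hx
    rw [hθ', hx, map_zero, sub_zero, hF]
  · intro m' d' hd'
    refine exists_lift G hfree d' θ' ?_
    rw [hd']
    rintro _ ⟨x, rfl⟩
    exact LinearMap.mem_ker.2 (hθ'0 x : d (θ' x) = (0 : P))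

/-! ### The simplicial chains -/

/-- The action on `Λ × G`. -/
@[reducible] def actT (Λ : Type) : MulAction G (Λ × G) where
  smul g p := (p.1, g * p.2)
  one_smul p := by
    change (p.1, 1 * p.2) = p
    simp
  mul_smul g h p := by
    change (p.1, g * h * p.2) = (p.1, g * (h * p.2))
    rw [mul_assoc]

attribute [local instance] actT

/-- Simplices of `EG(Λ)`. -/
abbrev Sx (Λ : Type) (m : ℕ) : Type := Fin (m + 1) → Λ × G

theorem smul_sx (Λ : Type) (m : ℕ) (g : G) (v : Sx G Λ m) :
    g • v = fun i => (((v i).1, g * (v i).2) : Λ × G) := rfl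

theorem sx_projective (Λ : Type) (m : ℕ) : Module.Projective (GRing G) (Sx G Λ m →₀ ℤ) :=
  ch_projective G (fun v => (v 0).2) (fun _ _ => rfl)

/-- Boundary as a linear map. -/
noncomputable def bd (Λ : Type) (m : ℕ) : (Sx G Λ (m + 1) →₀ ℤ) →ₗ[GRing G] (Sx G Λ m →₀ ℤ) :=
  liftS G (fun v => ∑ i : Fin (m + 2),
    ((-1 : ℤ) ^ (i : ℕ)) • (Finsupp.single (v ∘ i.succAbove) 1 : Sx G Λ m →₀ ℤ)) (by
    intro g v
    rw [Finset.smul_sum]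
    refine Finset.sum_congr rfl fun i _ => ?_
    rw [smul_zsmul_aux, gr_smul_single]
    rfl)

theorem bd_single (Λ : Type) (m : ℕ) (v : Sx G Λ (m + 1)) :
    bd G Λ m (Finsupp.single v 1) = ∑ i : Fin (m + 2),
    ((-1 : ℤ) ^ (i : ℕ)) • (Finsupp.single (v ∘ i.succAbove) 1 : Sx G Λ m →₀ ℤ) := by
  rw [bd, liftS_single, one_smul]

theorem sBoundary_eq (Λ : Type) (m : ℕ) (c : Sx G Λ (m + 1) →₀ ℤ) :
    sBoundary (Λ × G) m c = bd G Λ m c := by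
  rw [bd, liftS_apply, sBoundary]
  refine Finsupp.sum_congr fun v _ => ?_
  rw [Finset.smul_sum]
  refine Finset.sum_congr rfl fun i _ => ?_
  rw [smul_smul, mul_comm]

theorem supp_mem {S : Type} (X : Set S) (N : AddSubgroup (S →₀ ℤ))
    (h : ∀ v ∈ X, Finsupp.single v 1 ∈ N) (c : S →₀ ℤ) (hc : ↑c.support ⊆ X) : c ∈ N := by
  rw [← Finsupp.sum_single c]
  refine AddSubgroup.sum_mem _ fun v hv => ?_
  have : (Finsupp.single v (c v) : S →₀ ℤ) = c v • Finsupp.single v 1 := by simp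
  rw [this]
  exact N.zsmul_mem (h v (hc hv)) _

theorem supp_eq {S N : Type} [AddCommGroup N] (X : Set S) (f fb : (S →₀ ℤ) →+ N)
    (h : ∀ v ∈ X, f (Finsupp.single v 1) = fb (Finsupp.single v 1)) (c : S →₀ ℤ)
    (hc : ↑c.support ⊆ X) : f c = fb c :=
  supp_mem X (AddMonoidHom.eqLocus f fb) h c hc

/-- The cone operator. -/
noncomputable def cone (Λ : Type) (t : Λ × G → Λ × G) (m : ℕ) :
    (Sx G Λ m →₀ ℤ) →+ (Sx G Λ (m + 1) →₀ ℤ) :=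
  Finsupp.mapDomain.addMonoidHom (fun v => Fin.cons (t (v 0)) v)

theorem cone_single (Λ : Type) (t : Λ × G → Λ × G) (m : ℕ) (v : Sx G Λ m) :
    cone G Λ t m (Finsupp.single v 1) = Finsupp.single (Fin.cons (t (v 0)) v) 1 := by
  simp [cone, Finsupp.mapDomain_single]

theorem cone_bd (Λ : Type) (t : Λ × G → Λ × G) (m : ℕ) (v : Sx G Λ (m + 1))
    (hv : ∀ i, t (v i) = t (v 0)) :
    bd G Λ (m + 1) (cone G Λ t (m + 1) (Finsupp.single v 1)) =
      Finsupp.single v 1 - cone G Λ t m (bd G Λ m (Finsupp.single v 1)) := by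
  rw [cone_single, bd_single, bd_single, Fin.sum_univ_succ, map_sum, sub_eq_add_neg,
    ← Finset.sum_neg_distrib]
  congr 1
  · have : (Fin.cons (t (v 0)) v : Sx G Λ (m + 2)) ∘ Fin.succAbove 0 = v := by
      ext1 j
      simp
    rw [this]
    simp
  · refine Finset.sum_congr rfl fun i _ => ?_
    rw [map_zsmul, cone_single]
    have : (Fin.cons (t (v 0)) v : Sx G Λ (m + 2)) ∘ Fin.succAbove i.succ =
        Fin.cons (t ((v ∘ i.succAbove) 0)) (v ∘ i.succAbove) := by
      ext1 j
      refine Fin.cases ?_ (fun j => ?_) j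
      · simp [hv]
      · simp
    rw [this, Fin.val_succ, pow_succ]
    simp

theorem cone_bd_zero (Λ : Type) (t : Λ × G → Λ × G) (v : Sx G Λ 0) :
    bd G Λ 0 (cone G Λ t 0 (Finsupp.single v 1)) =
      Finsupp.single v 1 - Finsupp.single (fun _ => t (v 0)) 1 := by
  rw [cone_single, bd_single, Fin.sum_univ_two]
  have h0 : (Fin.cons (t (v 0)) v : Sx G Λ 1) ∘ Fin.succAbove 0 = v := by
    ext1 j
    simp
  have h1 : (Fin.cons (t (v 0)) v : Sx G Λ 1) ∘ Fin.succAbove 1 = fun _ => t (v 0) := by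
    ext1 j
    have : j = 0 := Subsingleton.elim _ _
    subst this
    simp [Fin.succAbove]
  rw [h0, h1]
  simp [sub_eq_add_neg]

/-- augmentation -/
noncomputable def aug (S : Type) : (S →₀ ℤ) →+ ℤ :=
  Finsupp.liftAddHom (fun _ => AddMonoidHom.id ℤ)

theorem aug_eq (S : Type) (c : S →₀ ℤ) : aug S c = c.sum fun _ k => k := rfl

theorem aug_single (S : Type) (s : S) (k : ℤ) : aug S (Finsupp.single s k) = k := by
  simp [aug]

theorem aug_bd (Λ : Type) (c : Sx G Λ 1 →₀ ℤ) : aug _ (bd G Λ 0 c) = 0 := by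
  refine supp_eq Set.univ ((aug _).comp (bd G Λ 0).toAddMonoidHom) 0 ?_ c (Set.subset_univ _)
  intro v _
  change aug _ (bd G Λ 0 (Finsupp.single v 1)) = 0
  rw [bd_single, Fin.sum_univ_two, map_add, map_zsmul, map_zsmul, aug_single, aug_single]
  simp

theorem bd_bd_single (Λ : Type) (m : ℕ) : ∀ v : Sx G Λ (m + 2),
    bd G Λ m (bd G Λ (m + 1) (Finsupp.single v 1)) = 0 := by
  have cons_eq : ∀ (k : ℕ) (v : Sx G Λ (k + 1)), (Finsupp.single v 1 : Sx G Λ (k + 1) →₀ ℤ) =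
      cone G Λ (fun _ => v 0) k (Finsupp.single (Fin.tail v) 1) := by
    intro k v
    rw [cone_single, Fin.cons_self_tail]
  induction m with
  | zero =>
    intro v
    rw [cons_eq _ v, cone_bd G Λ _ 0 _ (fun _ => rfl), map_sub, sub_eq_zero]
    generalize Fin.tail v = w
    rw [bd_single, Fin.sum_univ_two, map_add, map_add, map_zsmul, map_zsmul, map_zsmul, map_zsmul,
      cone_bd_zero, cone_bd_zero]
    simp only [smul_sub]
    simp
  | succ m ih =>
    intro v
    have ih' : ∀ c, bd G Λ m (bd G Λ (m + 1) c) = 0 := fun c =>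
      supp_eq Set.univ ((bd G Λ m).toAddMonoidHom.comp (bd G Λ (m + 1)).toAddMonoidHom) 0
        (fun v _ => ih v) c (Set.subset_univ _)
    have hc : ∀ c, bd G Λ (m + 1) (cone G Λ (fun _ => v 0) (m + 1) c) =
        c - cone G Λ (fun _ => v 0) m (bd G Λ m c) := fun c =>
      supp_eq Set.univ ((bd G Λ (m + 1)).toAddMonoidHom.comp (cone G Λ (fun _ => v 0) (m + 1)))
        (AddMonoidHom.id (Sx G Λ (m + 1) →₀ ℤ) - (cone G Λ (fun _ => v 0) m).comp (bd G Λ m).toAddMonoidHom)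
        (fun w _ => cone_bd G Λ (fun _ => v 0) m w (fun _ => rfl)) c (Set.subset_univ _)
    rw [cons_eq _ v, cone_bd G Λ _ (m + 1) _ (fun _ => rfl), map_sub, hc, ih', map_zero, sub_zero,
      sub_self]

theorem bd_bd (Λ : Type) (m : ℕ) (c : Sx G Λ (m + 2) →₀ ℤ) :
    bd G Λ m (bd G Λ (m + 1) c) = 0 :=
  supp_eq Set.univ ((bd G Λ m).toAddMonoidHom.comp (bd G Λ (m + 1)).toAddMonoidHom) 0
    (fun v _ => bd_bd_single G Λ m v) c (Set.subset_univ _)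

/-- Chains supported on an invariant set of simplices. -/
def cs {S : Type} [MulAction G S] (X : Set S) (hX : ∀ (g : G), ∀ v ∈ X, g • v ∈ X) :
    Submodule (GRing G) (S →₀ ℤ) where
  carrier := {c | ↑c.support ⊆ X}
  zero_mem' := by simp
  add_mem' := by
    classical
    intro a b ha hb v hv
    rcases Finset.mem_union.1 (Finsupp.support_add hv) with h | h
    · exact ha h
    · exact hb h
  smul_mem' := by
    classical
    intro r x hx
    induction r using MonoidAlgebra.induction_on with
    | of g =>
      change ↑(gr G g • x).support ⊆ X
      rw [gr_smul]
      intro v hv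
      obtain ⟨w, hw, rfl⟩ := Finset.mem_image.1 (Finsupp.mapDomain_support hv)
      exact hX g w (hx hw)
    | add a b ha hb =>
      rw [add_smul]
      intro v hv
      rcases Finset.mem_union.1 (Finsupp.support_add hv) with h | h
      · exact ha h
      · exact hb h
    | smul k a ha =>
      rw [smul_assoc]
      exact fun v hv => ha (Finsupp.support_smul hv)

theorem mem_cs {S : Type} [MulAction G S] (X : Set S) (hX : ∀ (g : G), ∀ v ∈ X, g • v ∈ X)
    (c : S →₀ ℤ) : c ∈ cs G X hX ↔ ↑c.support ⊆ X := Iff.rfl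

theorem single_mem_cs {S : Type} [MulAction G S] (X : Set S)
    (hX : ∀ (g : G), ∀ v ∈ X, g • v ∈ X) (v : S) (hv : v ∈ X) :
    Finsupp.single v 1 ∈ cs G X hX := by
  rw [mem_cs]
  intro w hw
  have := Finsupp.support_single_subset hw
  simp only [Finset.mem_singleton] at this
  exact this ▸ hv

theorem cs_le {S : Type} [MulAction G S] (X : Set S) (hX : ∀ (g : G), ∀ v ∈ X, g • v ∈ X)
    (N : Submodule (GRing G) (S →₀ ℤ)) (h : ∀ v ∈ X, Finsupp.single v 1 ∈ N) : cs G X hX ≤ N :=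
  fun c hc => supp_mem X N.toAddSubgroup h c hc

theorem bd_cs (Λ : Type) (m : ℕ) (X : Set (Sx G Λ (m + 1)))
    (hX : ∀ (g : G), ∀ v ∈ X, g • v ∈ X) (Y : Set (Sx G Λ m))
    (hY : ∀ (g : G), ∀ v ∈ Y, g • v ∈ Y)
    (hXY : ∀ v ∈ X, ∀ i : Fin (m + 2), v ∘ i.succAbove ∈ Y) :
    cs G X hX ≤ (cs G Y hY).comap (bd G Λ m) := by
  apply cs_le
  intro v hv
  rw [Submodule.mem_comap, bd_single]
  exact Submodule.sum_mem _ fun i _ => zsmul_mem (single_mem_cs G Y hY _ (hXY v hv i)) _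

theorem base_inv {Λ : Type} (H : Λ → Subgroup G) (m : ℕ) (g : G) (v : Sx G Λ m)
    (hv : v ∈ baseSimplices G H m) : g • v ∈ baseSimplices G H m := by
  obtain ⟨α, h1, h2⟩ := hv
  refine ⟨α, h1, fun i j => ?_⟩
  have : ((g • v) i).2⁻¹ * ((g • v) j).2 = (v i).2⁻¹ * (v j).2 := by
    simp only [smul_sx]
    group
  rw [this]
  exact h2 i j

/-- Base chains. -/
def Bs {Λ : Type} (H : Λ → Subgroup G) (m : ℕ) : Submodule (GRing G) (Sx G Λ m →₀ ℤ) :=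
  cs G (baseSimplices G H m) (base_inv G H m)

theorem bd_Bs {Λ : Type} (H : Λ → Subgroup G) (m : ℕ) :
    Bs G H (m + 1) ≤ (Bs G H m).comap (bd G Λ m) := by
  apply bd_cs
  rintro v ⟨α, h1, h2⟩ i
  exact ⟨α, fun j => h1 _, fun j k => h2 _ _⟩

/-- Base point of the coset. -/
noncomputable def bp {Λ : Type} (H : Λ → Subgroup G) (p : Λ × G) : Λ × G :=
  (p.1, (p.2 : G ⧸ H p.1).out)

theorem bp_base {Λ : Type} (H : Λ → Subgroup G) (m : ℕ) (v : Sx G Λ m)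
    (hv : v ∈ baseSimplices G H m) (i j) : bp G H (v i) = bp G H (v j) := by
  obtain ⟨α, h1, h2⟩ := hv
  have hi := h1 i
  have hj := h1 j
  have hij := h2 i j
  generalize v i = a at *
  generalize v j = b at *
  obtain ⟨a1, a2⟩ := a
  obtain ⟨b1, b2⟩ := b
  simp only at hi hj hij
  subst hi
  subst hj
  simp only [bp]
  rw [QuotientGroup.eq.2 hij]

theorem cone_base {Λ : Type} (H : Λ → Subgroup G) (m : ℕ) (v : Sx G Λ m)
    (hv : v ∈ baseSimplices G H m) :
    (Fin.cons (bp G H (v 0)) v : Sx G Λ (m + 1)) ∈ baseSimplices G H (m + 1) := by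
  obtain ⟨α, h1, h2⟩ := hv
  have h0 : (bp G H (v 0)).1 = α := h1 0
  have h3 : ∀ i, (bp G H (v 0)).2⁻¹ * (v i).2 ∈ H α := by
    intro i
    have := h1 0
    subst this
    have e : (bp G H (v 0)).2⁻¹ * (v 0).2 ∈ H (v 0).1 := by
      rw [← QuotientGroup.eq]
      exact QuotientGroup.out_eq' _
    have := (H (v 0).1).mul_mem e (h2 0 i)
    rwa [mul_assoc, mul_inv_cancel_left] at this
  refine ⟨α, ?_, ?_⟩
  · intro i
    refine Fin.cases ?_ (fun i => ?_) i
    · simpa using h0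
    · simpa using h1 i
  · intro i j
    refine Fin.cases ?_ (fun i => ?_) i
    · refine Fin.cases ?_ (fun j => ?_) j
      · simp [(H α).one_mem]
      · simpa using h3 j
    · refine Fin.cases ?_ (fun j => ?_) j
      · have := (H α).inv_mem (h3 i)
        simpa using this
      · simpa using h2 i j

theorem cone_mem_Bs {Λ : Type} (H : Λ → Subgroup G) (m : ℕ) (c : Sx G Λ m →₀ ℤ)
    (hc : c ∈ Bs G H m) : cone G Λ (bp G H) m c ∈ Bs G H (m + 1) := by
  refine supp_mem (baseSimplices G H m)
    ((Bs G H (m + 1)).toAddSubgroup.comap (cone G Λ (bp G H) m)) ?_ c hc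
  intro v hv
  change cone G Λ (bp G H) m (Finsupp.single v 1) ∈ Bs G H (m + 1)
  rw [cone_single]
  exact single_mem_cs G _ _ _ (cone_base G H m v hv)

theorem base_acyclic {Λ : Type} (H : Λ → Subgroup G) (m : ℕ) (c : Sx G Λ (m + 1) →₀ ℤ)
    (hc : c ∈ Bs G H (m + 1)) (h0 : bd G Λ m c = 0) :
    ∃ e ∈ Bs G H (m + 2), bd G Λ (m + 1) e = c := by
  refine ⟨cone G Λ (bp G H) (m + 1) c, cone_mem_Bs G H _ c hc, ?_⟩
  have : bd G Λ (m + 1) (cone G Λ (bp G H) (m + 1) c) =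
      c - cone G Λ (bp G H) m (bd G Λ m c) :=
    supp_eq (baseSimplices G H (m + 1))
      ((bd G Λ (m + 1)).toAddMonoidHom.comp (cone G Λ (bp G H) (m + 1)))
      (AddMonoidHom.id (Sx G Λ (m + 1) →₀ ℤ) - (cone G Λ (bp G H) m).comp (bd G Λ m).toAddMonoidHom)
      (fun w hw => cone_bd G Λ (bp G H) m w (fun _ => bp_base G H _ w hw _ _)) c hc
  rw [this, h0, map_zero, sub_zero]

/-- The coset of a vertex. -/
def cst {Λ : Type} (H : Λ → Subgroup G) (p : Λ × G) : cosetUnion G H := ⟨p.1, (p.2 : G ⧸ H p.1)⟩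

/-- The projection from vertices to cosets. -/
noncomputable def qv {Λ : Type} (H : Λ → Subgroup G) :
    (Sx G Λ 0 →₀ ℤ) →ₗ[GRing G] (cosetUnion G H →₀ ℤ) :=
  liftS G (fun v => Finsupp.single (cst G H (v 0)) 1) (by
    intro g v
    rw [gr_smul_single]
    rfl)

theorem qv_single {Λ : Type} (H : Λ → Subgroup G) (v : Sx G Λ 0) :
    qv G H (Finsupp.single v 1) = Finsupp.single (cst G H (v 0)) 1 := by
  rw [qv, liftS_single, one_smul]

theorem base_zero {Λ : Type} (H : Λ → Subgroup G) (c : Sx G Λ 0 →₀ ℤ) : c ∈ Bs G H 0 := by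
  rw [Bs, mem_cs]
  intro v _
  have : Subsingleton (Fin (0 + 1)) := inferInstanceAs (Subsingleton (Fin 1))
  refine ⟨(v 0).1, fun i => ?_, fun i j => ?_⟩
  · rw [Subsingleton.elim i 0]
  · rw [Subsingleton.elim i j, inv_mul_cancel]
    exact one_mem _

theorem base_acyclic_zero {Λ : Type} (H : Λ → Subgroup G) (c : Sx G Λ 0 →₀ ℤ)
    (h0 : qv G H c = 0) : ∃ e ∈ Bs G H 1, bd G Λ 0 e = c := by
  refine ⟨cone G Λ (bp G H) 0 c, cone_mem_Bs G H _ c (base_zero G H c), ?_⟩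
  let s : (cosetUnion G H →₀ ℤ) →+ (Sx G Λ 0 →₀ ℤ) :=
    Finsupp.mapDomain.addMonoidHom (fun q => fun _ => (q.1, q.2.out))
  have : bd G Λ 0 (cone G Λ (bp G H) 0 c) = c - s (qv G H c) :=
    supp_eq Set.univ
      ((bd G Λ 0).toAddMonoidHom.comp (cone G Λ (bp G H) 0))
      (AddMonoidHom.id (Sx G Λ 0 →₀ ℤ) - s.comp (qv G H).toAddMonoidHom)
      (fun w _ => by
        refine (cone_bd_zero G Λ (bp G H) w).trans ?_
        change _ = Finsupp.single w 1 - s (qv G H (Finsupp.single w 1))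
        rw [qv_single]
        simp [s, Finsupp.mapDomain_single, cst, bp]) c (Set.subset_univ _)
  rw [this, h0, map_zero, sub_zero]

theorem qv_base {Λ : Type} (H : Λ → Subgroup G) (c : Sx G Λ 1 →₀ ℤ) (hc : c ∈ Bs G H 1) :
    qv G H (bd G Λ 0 c) = 0 := by
  refine supp_eq (baseSimplices G H 1) ((qv G H).toAddMonoidHom.comp (bd G Λ 0).toAddMonoidHom)
    0 ?_ c hc
  rintro v ⟨α, h1, h2⟩
  change qv G H (bd G Λ 0 (Finsupp.single v 1)) = 0
  have e : cst G H (v 0) = cst G H (v 1) := by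
    have hi := h1 0
    have hj := h1 1
    have hij := h2 0 1
    generalize v 0 = a at *
    generalize v 1 = b at *
    obtain ⟨a1, a2⟩ := a
    obtain ⟨b1, b2⟩ := b
    simp only at hi hj hij
    subst hi
    subst hj
    simp only [cst]
    rw [QuotientGroup.eq.2 hij]
  rw [bd_single, Fin.sum_univ_two, map_add, map_zsmul, map_zsmul, qv_single, qv_single]
  simp [e]

theorem aug_qv {Λ : Type} (H : Λ → Subgroup G) (c : Sx G Λ 0 →₀ ℤ) :
    aug _ (qv G H c) = aug _ c := by
  refine supp_eq Set.univ ((aug _).comp (qv G H).toAddMonoidHom) (aug _) ?_ c (Set.subset_univ _)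
  intro v _
  change aug _ (qv G H (Finsupp.single v 1)) = _
  rw [qv_single, aug_single, aug_single]

theorem qv_surj {Λ : Type} (H : Λ → Subgroup G) (x : cosetUnion G H →₀ ℤ) :
    ∃ c, qv G H c = x := by
  change x ∈ LinearMap.range (qv G H)
  apply ch_span
  rintro ⟨α, q⟩
  obtain ⟨g, rfl⟩ := QuotientGroup.mk_surjective q
  exact ⟨Finsupp.single (fun _ => (α, g)) 1, qv_single G H _⟩

/-! ### The relative complex -/

/-- Relative chains (with a degree shift). -/
abbrev Dq {Λ : Type} (H : Λ → Subgroup G) (i : ℕ) : Type :=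
  (Sx G Λ (i + 1) →₀ ℤ) ⧸ Bs G H (i + 1)

theorem dq_projective {Λ : Type} (H : Λ → Subgroup G) (i : ℕ) :
    Module.Projective (GRing G) (Dq G H i) := by
  classical
  have hp := sx_projective G Λ (i + 1)
  let s : (Sx G Λ (i + 1) →₀ ℤ) →ₗ[GRing G] (Sx G Λ (i + 1) →₀ ℤ) :=
    liftS G (fun v => if v ∈ baseSimplices G H (i + 1) then 0 else Finsupp.single v 1) (by
      intro g v
      by_cases hv : v ∈ baseSimplices G H (i + 1)
      · rw [if_pos hv, if_pos (base_inv G H _ g v hv), smul_zero]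
      · have : g • v ∉ baseSimplices G H (i + 1) := by
          intro h
          have := base_inv G H _ g⁻¹ _ h
          rw [inv_smul_smul] at this
          exact hv this
        rw [if_neg hv, if_neg this, gr_smul_single])
  have hs : Bs G H (i + 1) ≤ LinearMap.ker s := by
    apply cs_le
    intro v hv
    rw [LinearMap.mem_ker, liftS_single, if_pos hv, smul_zero]
  refine Module.Projective.of_split ((Bs G H (i + 1)).liftQ s hs) (Bs G H (i + 1)).mkQ ?_
  apply Submodule.linearMap_qext
  apply lin_ext
  intro v
  change (Bs G H (i + 1)).mkQ (s (Finsupp.single v 1)) = (Bs G H (i + 1)).mkQ (Finsupp.single v 1)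
  rw [liftS_single, one_smul]
  by_cases hv : v ∈ baseSimplices G H (i + 1)
  · rw [if_pos hv, map_zero]
    symm
    rw [Submodule.mkQ_apply, Submodule.Quotient.mk_eq_zero]
    exact single_mem_cs G _ _ v hv
  · rw [if_neg hv]

/-- The relative boundary. -/
noncomputable def dd {Λ : Type} (H : Λ → Subgroup G) (i : ℕ) :
    Dq G H (i + 1) →ₗ[GRing G] Dq G H i :=
  (Bs G H (i + 2)).mapQ (Bs G H (i + 1)) (bd G Λ (i + 1)) (bd_Bs G H (i + 1))

theorem dd_mk {Λ : Type} (H : Λ → Subgroup G) (i : ℕ) (c : Sx G Λ (i + 2) →₀ ℤ) :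
    dd G H i ((Bs G H (i + 2)).mkQ c) = (Bs G H (i + 1)).mkQ (bd G Λ (i + 1) c) := rfl

/-- The connecting map. -/
noncomputable def eps {Λ : Type} (H : Λ → Subgroup G) :
    Dq G H 0 →ₗ[GRing G] (cosetUnion G H →₀ ℤ) :=
  (Bs G H 1).liftQ (qv G H ∘ₗ bd G Λ 0) (fun c hc => qv_base G H c hc)

theorem eps_mk {Λ : Type} (H : Λ → Subgroup G) (c : Sx G Λ 1 →₀ ℤ) :
    eps G H ((Bs G H 1).mkQ c) = qv G H (bd G Λ 0 c) := rfl

/-- The cycles. -/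
noncomputable def Zc {Λ : Type} (H : Λ → Subgroup G) : ∀ i, Submodule (GRing G) (Dq G H i)
  | 0 => LinearMap.ker (eps G H)
  | i + 1 => LinearMap.ker (dd G H i)

theorem dd_mem_Zc {Λ : Type} (H : Λ → Subgroup G) (i : ℕ) (x : Dq G H (i + 1)) :
    dd G H i x ∈ Zc G H i := by
  obtain ⟨c, rfl⟩ := Submodule.mkQ_surjective _ x
  cases i with
  | zero =>
    change eps G H _ = 0
    rw [dd_mk, eps_mk, bd_bd, map_zero]
  | succ i =>
    change dd G H i _ = 0
    rw [dd_mk, dd_mk, bd_bd, map_zero]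

/-- The augmentation kernel. -/
noncomputable def delta {Λ : Type} (H : Λ → Subgroup G) :
    Submodule (GRing G) (cosetUnion G H →₀ ℤ) where
  carrier := deltaSet G H
  zero_mem' := map_zero (aug (cosetUnion G H))
  add_mem' := by
    intro a b ha hb
    change aug _ _ = 0
    change aug _ _ = 0 at ha
    change aug _ _ = 0 at hb
    rw [map_add, ha, hb, add_zero]
  smul_mem' := by
    intro r x hx
    change aug _ _ = 0
    change aug _ _ = 0 at hx
    induction r using MonoidAlgebra.induction_on with
    | of g =>
      change aug _ (gr G g • x) = 0
      rw [← hx]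
      refine supp_eq Set.univ ((aug _).comp (DistribSMul.toAddMonoidHom _ (gr G g))) (aug _)
        ?_ x (Set.subset_univ _)
      intro v _
      change aug _ (gr G g • (Finsupp.single v 1 : cosetUnion G H →₀ ℤ)) = _
      rw [gr_smul_single, aug_single, aug_single]
    | add a b ha hb => rw [add_smul, map_add, ha, hb, add_zero]
    | smul k a ha => rw [smul_assoc, map_zsmul, ha, smul_zero]

theorem mem_delta {Λ : Type} (H : Λ → Subgroup G) (x : cosetUnion G H →₀ ℤ) :
    x ∈ delta G H ↔ aug _ x = 0 := Iff.rfl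

theorem eps_mem {Λ : Type} (H : Λ → Subgroup G) (x : Dq G H 0) : eps G H x ∈ delta G H := by
  obtain ⟨c, rfl⟩ := Submodule.mkQ_surjective _ x
  rw [eps_mk, mem_delta, aug_qv, aug_bd]

theorem delta_fg {Λ : Type} (H : Λ → Subgroup G) (hΛ : Finite Λ) (hG : Group.FG G) :
    (delta G H).FG := by
  obtain ⟨S, hS⟩ := hG.out
  let e : Λ → (cosetUnion G H →₀ ℤ) := fun α => Finsupp.single ⟨α, ((1 : G) : G ⧸ H α)⟩ 1
  have haug : ∀ α, aug _ (e α) = 1 := fun α => aug_single _ _ _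
  have hge : ∀ α (g : G), gr G g • e α = Finsupp.single ⟨α, ((g : G) : G ⧸ H α)⟩ 1 := by
    intro α g
    rw [gr_smul_single]
    congr 1
    change (⟨α, (((g * 1 : G)) : G ⧸ H α)⟩ : cosetUnion G H) = _
    rw [mul_one]
  let A : Set (cosetUnion G H →₀ ℤ) := (Set.range fun p : Λ × Λ => e p.1 - e p.2) ∪
    (Set.range fun p : S × Λ => gr G p.1 • e p.2 - e p.2)
  refine Submodule.fg_def.2 ⟨A, (Set.finite_range _).union (Set.finite_range _), ?_⟩
  apply le_antisymm
  · rw [Submodule.span_le]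
    rintro _ (⟨p, rfl⟩ | ⟨p, rfl⟩)
    · change aug _ _ = 0
      simp only [map_sub, haug, sub_self]
    · change aug _ _ = 0
      simp only [map_sub, haug, hge, aug_single, sub_self]
  · set N := Submodule.span (GRing G) A
    have h1 : ∀ α α', e α - e α' ∈ N := fun α α' => Submodule.subset_span (Or.inl ⟨(α, α'), rfl⟩)
    have h2 : ∀ g : G, ∀ α, gr G g • e α - e α ∈ N := by
      intro g
      have hg : g ∈ Subgroup.closure (S : Set G) := by
        rw [hS]
        trivial
      induction hg using Subgroup.closure_induction with
      | mem s hs => exact fun α => Submodule.subset_span (Or.inr ⟨(⟨s, hs⟩, α), rfl⟩)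
      | one =>
        intro α
        rw [gr, map_one, one_smul, sub_self]
        exact zero_mem _
      | mul a b _ _ ha hb =>
        intro α
        have := add_mem (N.smul_mem (gr G a) (hb α)) (ha α)
        rw [smul_sub, ← mul_smul, ← map_mul, sub_add_sub_cancel] at this
        exact this
      | inv a _ ha =>
        intro α
        have := neg_mem (N.smul_mem (gr G a⁻¹) (ha α))
        rw [smul_sub, ← mul_smul, ← map_mul, inv_mul_cancel, map_one, one_smul, neg_sub] at this
        exact this
    intro x hx
    rw [mem_delta] at hx
    rcases isEmpty_or_nonempty Λ with hE | ⟨⟨α₀⟩⟩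
    · have : x = 0 := by
        ext ⟨α, q⟩
        exact (hE.false α).elim
      rw [this]
      exact zero_mem _
    · have key : x - aug _ x • e α₀ ∈ N := by
        refine supp_mem Set.univ (N.toAddSubgroup.comap (AddMonoidHom.id (cosetUnion G H →₀ ℤ) -
          (zmultiplesHom _ (e α₀)).comp (aug _))) ?_ x (Set.subset_univ _)
        rintro ⟨α, q⟩ _
        obtain ⟨g, rfl⟩ := QuotientGroup.mk_surjective q
        change Finsupp.single _ 1 - aug _ (Finsupp.single _ 1) • e α₀ ∈ N
        rw [aug_single, one_smul]
        have := add_mem (h2 g α) (h1 α α₀)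
        rwa [hge, sub_add_sub_cancel] at this
      rwa [hx, zero_smul, sub_zero] at key

theorem fg_of_fp (hG : IsFinitelyPresented G) : Group.FG G := by
  obtain ⟨n, rels, -, ⟨e⟩⟩ := hG
  have h : Function.Surjective (e.symm.toMonoidHom.comp (PresentedGroup.mk rels)) :=
    e.symm.surjective.comp (PresentedGroup.mk_surjective rels)
  exact Group.fg_of_surjective h

/-! ### The filtration, indexed by natural numbers -/

/-- The filtration of the relative complex. -/
noncomputable def Af {Λ : Type} (H : Λ → Subgroup G) (X : ℕ → ∀ m : ℕ, Set (Sx G Λ m))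
    (hX : ∀ k m (g : G), ∀ v ∈ X k m, g • v ∈ X k m) (i k : ℕ) :
    Submodule (GRing G) (Dq G H i) :=
  (cs G (X k (i + 1)) (hX k (i + 1))).map (Bs G H (i + 1)).mkQ

theorem Af_fg {Λ : Type} (H : Λ → Subgroup G) (X : ℕ → ∀ m : ℕ, Set (Sx G Λ m))
    (hX : ∀ k m (g : G), ∀ v ∈ X k m, g • v ∈ X k m) (i k : ℕ)
    (hfin : ∃ F : Finset (Sx G Λ (i + 1)),
      ∀ v ∈ X k (i + 1) \ baseSimplices G H (i + 1), ∃ (g : G) (w : Sx G Λ (i + 1)),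
        w ∈ F ∧ v = g • w) : (Af G H X hX i k).FG := by
  classical
  obtain ⟨F, hF⟩ := hfin
  let q := (Bs G H (i + 1)).mkQ
  refine Submodule.fg_def.2 ⟨(fun w => q (Finsupp.single w 1)) '' {w | w ∈ F ∧ w ∈ X k (i + 1)},
    Set.Finite.image _ (F.finite_toSet.subset fun w hw => hw.1), ?_⟩
  apply le_antisymm
  · rw [Submodule.span_le]
    rintro _ ⟨w, hw, rfl⟩
    exact ⟨_, single_mem_cs G _ _ w hw.2, rfl⟩
  · rw [Af, Submodule.map_le_iff_le_comap]
    apply cs_le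
    intro v hv
    rw [Submodule.mem_comap]
    by_cases hb : v ∈ baseSimplices G H (i + 1)
    · have : (Bs G H (i + 1)).mkQ (Finsupp.single v 1) = 0 := by
        rw [Submodule.mkQ_apply, Submodule.Quotient.mk_eq_zero]
        exact single_mem_cs G _ _ v hb
      rw [this]
      exact zero_mem _
    · obtain ⟨g, w, hw, rfl⟩ := hF v ⟨hv, hb⟩
      have hwX : w ∈ X k (i + 1) := by
        have := hX k (i + 1) g⁻¹ _ hv
        rwa [inv_smul_smul] at this
      rw [← gr_smul_single, map_smul]
      exact Submodule.smul_mem _ _ (Submodule.subset_span ⟨w, ⟨hw, hwX⟩, rfl⟩)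

theorem exact_step {Λ : Type} (H : Λ → Subgroup G) (X : ℕ → ∀ m : ℕ, Set (Sx G Λ m))
    (hX : ∀ k m (g : G), ∀ v ∈ X k m, g • v ∈ X k m)
    (hbase : ∀ k m, baseSimplices G H m ⊆ X k m) (i k : ℕ)
    (htriv : ∀ c ∈ cs G (X k (i + 1)) (hX k (i + 1)), bd G Λ i c = 0 →
      ∃ e ∈ cs G (X (k + 1) (i + 2)) (hX (k + 1) (i + 2)), bd G Λ (i + 1) e = c)
    (x : Dq G H i) (hx : x ∈ Af G H X hX i k) (hz : x ∈ Zc G H i) :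
    ∃ y ∈ Af G H X hX (i + 1) (k + 1), dd G H i y = x := by
  obtain ⟨c, hc, rfl⟩ := hx
  have key : ∃ c' ∈ Bs G H (i + 1), bd G Λ i c' = bd G Λ i c := by
    cases i with
    | zero => exact base_acyclic_zero G H (bd G Λ 0 c) hz
    | succ i =>
      change dd G H i _ = 0 at hz
      rw [dd_mk, Submodule.mkQ_apply, Submodule.Quotient.mk_eq_zero] at hz
      exact base_acyclic G H i _ hz (bd_bd G Λ i c)
  obtain ⟨c', hc', hcc⟩ := key
  have hc'X : c' ∈ cs G (X k (i + 1)) (hX k (i + 1)) := fun v hv => hbase k (i + 1) (hc' hv)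
  obtain ⟨e, he, hec⟩ := htriv (c - c') (sub_mem hc hc'X) (by rw [map_sub, hcc, sub_self])
  refine ⟨_, ⟨e, he, rfl⟩, ?_⟩
  rw [dd_mk, hec, map_sub, sub_eq_self, Submodule.mkQ_apply, Submodule.Quotient.mk_eq_zero]
  exact hc'

theorem eps_surj {Λ : Type} (H : Λ → Subgroup G) (X : ℕ → ∀ m : ℕ, Set (Sx G Λ m))
    (hX : ∀ k m (g : G), ∀ v ∈ X k m, g • v ∈ X k m) (k : ℕ)
    (htriv : ∀ c : Sx G Λ 0 →₀ ℤ, aug _ c = 0 →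
      ∃ e ∈ cs G (X (k + 1) 1) (hX (k + 1) 1), bd G Λ 0 e = c)
    (x : cosetUnion G H →₀ ℤ) (hx : x ∈ delta G H) :
    ∃ y ∈ Af G H X hX 0 (k + 1), eps G H y = x := by
  obtain ⟨c, rfl⟩ := qv_surj G H x
  rw [mem_delta, aug_qv] at hx
  obtain ⟨e, he, hec⟩ := htriv c hx
  exact ⟨_, ⟨e, he, rfl⟩, by rw [eps_mk, hec]⟩

/-- The resolution, over the group ring. -/
theorem exists_resolution_s13 {Λ : Type} (H : Λ → Subgroup G) (hΛ : Finite Λ) (hG : Group.FG G)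
    (n : ℕ) (X : ℕ → ∀ m : ℕ, Set (Sx G Λ m))
    (hX : ∀ k m (g : G), ∀ v ∈ X k m, g • v ∈ X k m)
    (hbase : ∀ k m, baseSimplices G H m ⊆ X k m)
    (hfin : ∀ k m, m ≤ n → ∃ F : Finset (Sx G Λ m),
      ∀ v ∈ X k m \ baseSimplices G H m, ∃ (g : G) (w : Sx G Λ m), w ∈ F ∧ v = g • w)
    (htriv0 : ∀ k, ∀ c : Sx G Λ 0 →₀ ℤ, aug _ c = 0 →
      ∃ e ∈ cs G (X (k + 1) 1) (hX (k + 1) 1), bd G Λ 0 e = c)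
    (htriv : ∀ k i, i + 1 ≤ n → ∀ c ∈ cs G (X k (i + 1)) (hX k (i + 1)), bd G Λ i c = 0 →
      ∃ e ∈ cs G (X (k + 1) (i + 2)) (hX (k + 1) (i + 2)), bd G Λ (i + 1) e = c) :
    ∃ (m : ℕ → ℕ)
      (d : ∀ i : ℕ, ((G × Fin (m (i + 1))) →₀ ℤ) →ₗ[GRing G] ((G × Fin (m i)) →₀ ℤ))
      (π : ((G × Fin (m 0)) →₀ ℤ) →ₗ[GRing G] ((cosetUnion G H) →₀ ℤ)),
      LinearMap.range π = delta G H ∧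
      (2 ≤ n → LinearMap.ker π = LinearMap.range (d 0)) ∧
      (∀ i : ℕ, i + 3 ≤ n → LinearMap.ker (d i) = LinearMap.range (d (i + 1))) := by
  let A := Af G H X hX
  have hdfg := delta_fg G H hΛ hG
  obtain ⟨m0, π, hπ⟩ := exists_cover_s13 G (delta G H) hdfg
  have hfg : ∀ i k, i + 1 ≤ n → (A i k).FG := fun i k hi => Af_fg G H X hX i k (hfin k _ hi)
  have hex : ∀ i k, i + 1 ≤ n → ∀ x ∈ A i k, x ∈ Zc G H i →
      ∃ y ∈ A (i + 1) (k + 1), dd G H i y = x := fun i k hi =>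
    exact_step G H X hX hbase i k (htriv k i hi)
  let M := cosetUnion G H →₀ ℤ
  have good0 : Good G (fun _ => (⊤ : Submodule (GRing G) M)) (delta G H) (delta G H) := by
    refine ⟨hdfg, LinearMap.id, LinearMap.id, 0, 0, fun _ => trivial, fun x hx => hx,
      fun x hx => hx, fun _ => zero_mem _, fun x _ => ?_, fun m d _ => ⟨0, ?_⟩⟩
    · simp
    · simp
  have good1 : 2 ≤ n → Good G (A 0) (Zc G H 0) (LinearMap.ker π) := by
    intro hn
    exact good_step G (dq_projective G H 0) (fun _ => ⊤) (delta G H) (A 0) (A 1) (eps G H)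
      (dd G H 0) (fun x => dd_mem_Zc G H 0 x) (eps_mem G H)
      (fun k x _ hx => eps_surj G H X hX k (htriv0 k) x hx)
      (fun k => hex 0 k (by omega)) (fun k => hfg 1 k hn) (delta G H) m0 π hπ good0
  have step : ∀ (i : ℕ) (s : Σ m : ℕ, Submodule (GRing G) ((G × Fin m) →₀ ℤ)),
      ∃ (m' : ℕ) (d : ((G × Fin m') →₀ ℤ) →ₗ[GRing G] ((G × Fin s.1) →₀ ℤ)),
        (i + 2 ≤ n → Good G (A i) (Zc G H i) s.2) → ((i + 2 ≤ n → LinearMap.range d = s.2) ∧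
        (i + 3 ≤ n → Good G (A (i + 1)) (Zc G H (i + 1)) (LinearMap.ker d))) := by
    rintro i ⟨m, K⟩
    by_cases hi : i + 2 ≤ n ∧ (i + 2 ≤ n → Good G (A i) (Zc G H i) K)
    · obtain ⟨m', d, hd⟩ := exists_cover_s13 G K (hi.2 hi.1).1
      refine ⟨m', d, fun _ => ⟨fun _ => hd, fun hi3 => ?_⟩⟩
      exact good_step G (dq_projective G H (i + 1)) (A i) (Zc G H i) (A (i + 1)) (A (i + 2))
        (dd G H i) (dd G H (i + 1)) (fun x => dd_mem_Zc G H (i + 1) x) (dd_mem_Zc G H i)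
        (fun k => hex i k (by omega)) (fun k => hex (i + 1) k (by omega))
        (fun k => hfg (i + 2) k hi3) K m' d hd (hi.2 hi.1)
    · refine ⟨0, 0, fun h => ⟨fun h2 => (hi ⟨h2, h⟩).elim, fun h3 => (hi ⟨by omega, h⟩).elim⟩⟩
  choose m' d' hd' using step
  let σ : ℕ → Σ m : ℕ, Submodule (GRing G) ((G × Fin m) →₀ ℤ) := fun i =>
    Nat.rec ⟨m0, LinearMap.ker π⟩ (fun i s => ⟨m' i s, LinearMap.ker (d' i s)⟩) i
  have hσ : ∀ i, i + 2 ≤ n → Good G (A i) (Zc G H i) (σ i).2 := by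
    intro i
    induction i with
    | zero => exact good1
    | succ i ih => exact (hd' i (σ i) ih).2
  refine ⟨fun i => (σ i).1, fun i => d' i (σ i), π, hπ, fun hn => ?_, fun i hi => ?_⟩
  · exact ((hd' 0 (σ 0) (hσ 0)).1 hn).symm
  · exact ((hd' (i + 1) (σ (i + 1)) (hσ (i + 1))).1 hi).symm

/-- Forget to a `ℤ`-linear map. -/
noncomputable def toZLin {S S' : Type} [MulAction G S] [MulAction G S']
    (f : (S →₀ ℤ) →ₗ[GRing G] (S' →₀ ℤ)) : (S →₀ ℤ) →ₗ[ℤ] (S' →₀ ℤ) where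
  toFun := f
  map_add' := map_add f
  map_smul' r x := by
    simpa using map_zsmul f.toAddMonoidHom r x

/-- Brown-type criterion, relative case: let `Λ` be finite, each `H_α`
finitely generated and `G` finitely presented.  Suppose `{X_β}` is a filtration of
`EG(Λ) = S_•(Λ × G)` of finite `n`-type relative to `{H_α}` such that the directed
system of reduced homologies `{H̃_m (X_β)}` is essentially trivial for all `m ≤ n`.
Then the augmentation kernel `Δ` is of type `FP^{n-1}` over `ℤ[G]`. -/
theorem brown_criterion_relative
    {Λ : Type} (H : Λ → Subgroup G)
    (hΛ : Finite Λ)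
    (hH : ∀ α : Λ, (H α).FG)
    (hG : IsFinitelyPresented G)
    (n : ℕ)
    -- the filtration `{X_β}`, given by its sets of `m`-simplices
    (β : Type) [Preorder β] (hβne : Nonempty β)
    (hdir : ∀ b₁ b₂ : β, ∃ b₃ : β, b₁ ≤ b₃ ∧ b₂ ≤ b₃)
    (Xf : β → ∀ m : ℕ, Set (Fin (m + 1) → Λ × G))
    -- each `X_β` is a sub-simplicial set: closed under all simplicial operators
    (hsimp : ∀ (b : β) (m m' : ℕ) (θ : Fin (m' + 1) →o Fin (m + 1))
      (v : Fin (m + 1) → Λ × G), v ∈ Xf b m → v ∘ θ ∈ Xf b m')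
    -- each `X_β` is `G`-invariant
    (hGinv : ∀ (b : β) (m : ℕ) (g : G) (v : Fin (m + 1) → Λ × G),
      v ∈ Xf b m → (fun i => (((v i).1, g * (v i).2) : Λ × G)) ∈ Xf b m)
    -- the filtration is increasing and exhausts `EG(Λ)`
    (hmono : ∀ (b₁ b₂ : β), b₁ ≤ b₂ → ∀ m, Xf b₁ m ⊆ Xf b₂ m)
    (hexhaust : ∀ (m : ℕ) (v : Fin (m + 1) → Λ × G), ∃ b : β, v ∈ Xf b m)
    -- each `X_β` contains `X_∅ = p⁻¹(⊔_α BH_α)`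
    (hbase : ∀ (b : β) (m : ℕ), baseSimplices G H m ⊆ Xf b m)
    -- relative finite `n`-type: finitely many `G`-orbits of simplices outside `X_∅`
    -- in each dimension `m ≤ n`
    (hfin : ∀ (b : β) (m : ℕ), m ≤ n → ∃ F : Finset (Fin (m + 1) → Λ × G),
      ∀ v ∈ Xf b m \ baseSimplices G H m, ∃ (g : G) (w : Fin (m + 1) → Λ × G),
        w ∈ F ∧ v = fun i => (((w i).1, g * (w i).2) : Λ × G))
    -- essential triviality of `{H̃_m(X_β)}` for all `m ≤ n`:  every reduced cycle of
    -- `X_{β₁}` bounds in some `X_{β₂}`, `β₂ ≥ β₁`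
    (htrivial : ∀ b₁ : β, ∃ b₂ : β, b₁ ≤ b₂ ∧
      -- degree `0` (reduced)
      ((∀ c : (Fin 1 → Λ × G) →₀ ℤ, ↑c.support ⊆ Xf b₁ 0 →
        (c.sum fun _ k => k) = 0 →
        ∃ e : (Fin 2 → Λ × G) →₀ ℤ, ↑e.support ⊆ Xf b₂ 1 ∧ sBoundary (Λ × G) 0 e = c) ∧
      -- degrees `1 ≤ m ≤ n`
      (∀ m : ℕ, m + 1 ≤ n → ∀ c : (Fin (m + 2) → Λ × G) →₀ ℤ,
        ↑c.support ⊆ Xf b₁ (m + 1) → sBoundary (Λ × G) m c = 0 →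
        ∃ e : (Fin (m + 3) → Λ × G) →₀ ℤ, ↑e.support ⊆ Xf b₂ (m + 2) ∧
          sBoundary (Λ × G) (m + 1) e = c))) :
    -- conclusion: `Δ` is of type `FP^{n-1}` over `ℤ[G]`
    ∃ (m : ℕ → ℕ)
      (d : ∀ i : ℕ, ((G × Fin (m (i + 1))) →₀ ℤ) →ₗ[ℤ] ((G × Fin (m i)) →₀ ℤ))
      (π : ((G × Fin (m 0)) →₀ ℤ) →ₗ[ℤ] ((cosetUnion G H) →₀ ℤ)),
      (∀ (i : ℕ) (g : G) (x : (G × Fin (m (i + 1))) →₀ ℤ),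
        d i (freeShift G g x) = freeShift G g (d i x)) ∧
      (∀ (g : G) (x : (G × Fin (m 0)) →₀ ℤ), π (freeShift G g x) = cosetShift G H g (π x)) ∧
      Set.range π = deltaSet G H ∧
      (1 ≤ n - 1 → ∀ x : (G × Fin (m 0)) →₀ ℤ, π x = 0 ↔ ∃ y, d 0 y = x) ∧
      (∀ i : ℕ, i + 2 ≤ n - 1 →
        ∀ x : (G × Fin (m (i + 1))) →₀ ℤ, d i x = 0 ↔ ∃ y, d (i + 1) y = x) := by
  classical
  choose nx hnx using htrivial
  obtain ⟨b0⟩ := hβne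
  let bs : ℕ → β := fun k => Nat.rec b0 (fun _ b => nx b) k
  let X : ℕ → ∀ m : ℕ, Set (Sx G Λ m) := fun k => Xf (bs k)
  have hX : ∀ k m (g : G), ∀ v ∈ X k m, g • v ∈ X k m := fun k m g v hv => hGinv (bs k) m g v hv
  obtain ⟨m, d, π, h1, h2, h3⟩ := exists_resolution_s13 G H hΛ (fg_of_fp G hG) n X hX
    (fun k m => hbase (bs k) m) (fun k m hm => hfin (bs k) m hm)
    (fun k c hc => by
      obtain ⟨e, he, hec⟩ := (hnx (bs k)).2.1 c
        ((base_zero G H c : ↑c.support ⊆ baseSimplices G H 0).trans (hbase _ _)) hc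
      exact ⟨e, he, (sBoundary_eq G Λ 0 e).symm.trans hec⟩)
    (fun k i hi c hc hc0 => by
      obtain ⟨e, he, hec⟩ := (hnx (bs k)).2.2 i hi c hc ((sBoundary_eq G Λ i c).trans hc0)
      exact ⟨e, he, (sBoundary_eq G Λ (i + 1) e).symm.trans hec⟩)
  refine ⟨m, fun i => toZLin G (d i), toZLin G π, ?_, ?_, ?_, ?_, ?_⟩
  · intro i g x
    have := map_smul (d i) (gr G g) x
    rw [gr_smul, gr_smul] at this
    exact this
  · intro g x
    have := map_smul π (gr G g) x
    rw [gr_smul, gr_smul] at this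
    exact this
  · exact congrArg (fun N : Submodule (GRing G) (cosetUnion G H →₀ ℤ) => (N : Set (cosetUnion G H →₀ ℤ))) h1
  · intro hn x
    have : x ∈ LinearMap.ker π ↔ x ∈ LinearMap.range (d 0) := by rw [h2 (by omega)]
    exact this
  · intro i hi x
    have : x ∈ LinearMap.ker (d i) ↔ x ∈ LinearMap.range (d (i + 1)) := by rw [h3 i (by omega)]
    exact this
end
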